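/- arXiv:2005.12542 — 4 statements merged into one kernel-verified Lean document; each statement's English description precedes it below -/
import Mathlib

section
/- Let k = F_q be a finite field, V a finite-dimensional k-vector space, c ≥ 1, s ≥ 0, and let P̄ = (P_1,...,P_c) be a collection of maps P_i : V → k such that for every ā = (a_1,...,a_c) ∈ k^c \ {0} the map P_ā := Σ_{i=1}^c a_i P_i : V → k is s-uniform. Then the map P̄ : V → k^c is (s-c)-uniform. -/
open Classical in
theorem card_annihilator {k : Type*} [Field k] [Fintype k] (c : ℕ) (w : Fin c → k) (hw : w ≠ 0) :
    (Fintype.card k : ℝ) * (∑ a : Fin c → k, if ∑ i, a i * w i = 0 then (1 : ℝ) else 0)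
      = (Fintype.card k : ℝ) ^ c := by
  let f : (Fin c → k) →ₗ[k] k :=
    { toFun := fun a => ∑ i, a i * w i
      map_add' := by intro x y; simp [add_mul, Finset.sum_add_distrib]
      map_smul' := by intro x y; simp [Finset.mul_sum, mul_assoc] }
  have hf : f ≠ 0 := by
    intro h
    apply hw
    funext j
    have := congrArg (fun g => g (Pi.single j 1)) h
    simpa [f, Pi.single_apply] using this
  have h1 := Module.Dual.finrank_ker_add_one_of_ne_zero (f := f) hf
  have h2 := Module.card_eq_pow_finrank (K := k) (V := LinearMap.ker f)
  have h3 : (∑ a : Fin c → k, if ∑ i, a i * w i = 0 then (1 : ℝ) else 0)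
      = (Fintype.card (LinearMap.ker f) : ℝ) := by
    rw [Finset.sum_boole, Fintype.card_subtype]
    congr 1
  rw [Module.finrank_fin_fun] at h1
  rw [h3, h2]
  push_cast
  rw [← pow_succ', h1]

/-- Let `k = F_q` be a finite field, `V` a finite-dimensional `k`-vector space,
`c ≥ 1`, `s ≥ 0`, and `P̄ = (P_1,...,P_c)` a collection of maps `P_i : V → k` such that for
every `ā ∈ k^c \ {0}` the map `P_ā = ∑ i, a_i P_i` is `s`-uniform (i.e.
`|#{v | P_ā v = t} / q^(dim V - 1) - 1| ≤ q^(-s)` for all `t`).  Then the map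
`P̄ : V → k^c` is `(s - c)`-uniform. -/
theorem stmt0 {k : Type*} [Field k] [Fintype k] {V : Type*} [AddCommGroup V]
    [Module k V] [FiniteDimensional k V] [Fintype V]
    (c : ℕ) (hc : 1 ≤ c) (s : ℝ) (hs : 0 ≤ s) (P : Fin c → V → k)
    (huni : ∀ a : Fin c → k, a ≠ 0 → ∀ t : k,
      |(Nat.card {v : V // (∑ i, a i * P i v) = t} : ℝ) /
          (Fintype.card k : ℝ) ^ ((Module.finrank k V : ℤ) - 1) - 1|
        ≤ (Fintype.card k : ℝ) ^ (-s)) :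
    ∀ t : Fin c → k,
      |(Nat.card {v : V // ∀ i, P i v = t i} : ℝ) /
          (Fintype.card k : ℝ) ^ ((Module.finrank k V : ℤ) - c) - 1|
        ≤ (Fintype.card k : ℝ) ^ (-(s - c)) := by
  classical
  intro t
  set q : ℝ := (Fintype.card k : ℝ) with hq
  have hq1 : (2 : ℝ) ≤ q := by
    have : 1 < Fintype.card k := Fintype.one_lt_card
    rw [hq]; exact_mod_cast this
  have hq0 : (0 : ℝ) < q := by linarith
  have hM : (Fintype.card V : ℝ) = q ^ (Module.finrank k V : ℤ) := by
    rw [Module.card_eq_pow_finrank (K := k) (V := V), hq]; push_cast; simp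
  set M : ℝ := (Fintype.card V : ℝ) with hMdef
  have hM0 : 0 < M := by rw [hM]; positivity
  set Q : ℝ := q ^ c with hQ
  have hQ0 : 0 < Q := by positivity
  set N : ℝ := (Nat.card {v : V // ∀ i, P i v = t i} : ℝ) with hN
  set ε : ℝ := q ^ (-s) with hε
  have hε0 : 0 < ε := Real.rpow_pos_of_pos hq0 _
  have e1 : q ^ ((Module.finrank k V : ℤ) - 1) = M / q := by
    rw [zpow_sub₀ hq0.ne', ← hM, zpow_one]
  have e2 : q ^ ((Module.finrank k V : ℤ) - c) = M / Q := by
    rw [zpow_sub₀ hq0.ne', ← hM, zpow_natCast]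
  have e3 : q ^ (-(s - c)) = Q * ε := by
    rw [show -(s - c) = (c : ℝ) + -s by ring, Real.rpow_add hq0, Real.rpow_natCast]
  rw [e2, e3]
  rw [e1] at huni
  -- the counts
  let g : (Fin c → k) → ℝ := fun a => ∑ v : V, if ∑ i, a i * (P i v - t i) = 0 then (1 : ℝ) else 0
  have hg : ∀ a, a ≠ 0 → |g a * q / M - 1| ≤ ε := by
    intro a ha
    have h := huni a ha (∑ i, a i * t i)
    have : (Nat.card {v : V // (∑ i, a i * P i v) = ∑ i, a i * t i} : ℝ) = g a := by
      simp only [g]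
      rw [Finset.sum_boole, Nat.card_eq_fintype_card, Fintype.card_subtype]
      simp only [mul_sub, Finset.sum_sub_distrib, sub_eq_zero]
    rw [this] at h
    convert h using 3
    field_simp
  have hg0 : g 0 = M := by simp [g, hMdef]
  have hNs : N = ∑ v : V, if ∀ i, P i v = t i then (1 : ℝ) else 0 := by
    rw [hN, Finset.sum_boole, Nat.card_eq_fintype_card, Fintype.card_subtype]
  have hcardA : ((Finset.univ : Finset (Fin c → k)).card : ℝ) = Q := by
    simp [hQ, hq]
  have hsum : q * ∑ a, g a = N * (Q * q - Q) + M * Q := by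
    simp only [g]
    rw [Finset.sum_comm, Finset.mul_sum, hNs, Finset.sum_mul]
    have : M * Q = ∑ v : V, Q := by simp [hMdef]
    rw [this, ← Finset.sum_add_distrib]
    apply Finset.sum_congr rfl
    intro v _
    by_cases hv : ∀ i, P i v = t i
    · simp only [hv, sub_self, mul_zero, Finset.sum_const_zero, if_true, implies_true,
        Finset.sum_const, nsmul_eq_mul, hcardA]
      ring
    · rw [if_neg hv, card_annihilator c (fun i => P i v - t i)]
      · ring
      · intro h
        apply hv
        intro i
        exact sub_eq_zero.mp (congrFun h i)
  have hE : |∑ a ∈ Finset.univ.erase (0 : Fin c → k), (g a * q / M - 1)| ≤ (Q - 1) * ε := by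
    refine (Finset.abs_sum_le_sum_abs _ _).trans ?_
    refine (Finset.sum_le_card_nsmul _ _ ε ?_).trans ?_
    · intro a ha
      exact hg a (Finset.ne_of_mem_erase ha)
    · rw [nsmul_eq_mul, Finset.cast_card_erase_of_mem (Finset.mem_univ _), hcardA]
  have hE2 : ∑ a ∈ Finset.univ.erase (0 : Fin c → k), (g a * q / M - 1)
      = (q - 1) * (N / (M / Q) - 1) := by
    rw [← Finset.add_sum_erase _ _ (Finset.mem_univ (0 : Fin c → k)), hg0] at hsum
    rw [Finset.sum_sub_distrib, ← Finset.sum_div, ← Finset.sum_mul, Finset.sum_const,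
      nsmul_eq_mul, Finset.cast_card_erase_of_mem (Finset.mem_univ _), hcardA]
    have : (∑ a ∈ Finset.univ.erase (0 : Fin c → k), g a) * q
        = N * (Q * q - Q) + M * Q - q * M := by linarith
    rw [this]
    field_simp
    ring
  rw [hE2, abs_mul, abs_of_pos (by linarith : 0 < q - 1)] at hE
  have := abs_nonneg (N / (M / Q) - 1)
  nlinarith
end

section
/- For every c ≥ 1 and d ≥ 1 there exists a constant r = r(c,d) such that the following holds. Let K be an infinite field, V_1,...,V_d finite-dimensional K-vector spaces, and P̄ = (P_1,...,P_c) a collection of multilinear functions P_i : V_1 × ... × V_d → K (each P_i is K-linear in each of the d arguments separately) whose Schmidt rank is ≥ r. Then for every t̄ = (t_1,...,t_c) ∈ K^c there exists v ∈ V_1 × ... × V_d with P_i(v) = t_i for all 1 ≤ i ≤ c. -/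
open MvPolynomial

/-- The Schmidt rank of `P` (as a polynomial of degree `d`) is at least `r`: every way of
writing `P` as a sum of `m` products of two polynomials of total degree `< d` has `m ≥ r`. -/
def SchmidtRankGE {K : Type*} [CommRing K] {σ : Type*} (d : ℕ)
    (P : MvPolynomial σ K) (r : ℕ) : Prop :=
  ∀ (m : ℕ) (Q R : Fin m → MvPolynomial σ K),
    (∀ i, (Q i).totalDegree < d) → (∀ i, (R i).totalDegree < d) →
    P = ∑ i, Q i * R i → r ≤ m

/-- The symmetric multilinear form `P̃(h₁,…,h_d) = Δ_{h₁} ⋯ Δ_{h_d} P`, where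
`Δ_h P(x) = P(x+h) - P(x)`, written as a polynomial in the variables `h₁,…,h_d` via the
inclusion–exclusion formula `Δ_{h₁} ⋯ Δ_{h_d} P = ∑_{S ⊆ [d]} (-1)^{d-|S|} P(∑_{i∈S} hᵢ)`
(the result of `d` differencings of a polynomial of degree `≤ d` does not depend on the
base point `x`, so we evaluate at `x = 0`). -/
noncomputable def multiDiff {K : Type*} [CommRing K] {σ : Type*} (d : ℕ)
    (P : MvPolynomial σ K) : MvPolynomial (Fin d × σ) K :=
  ∑ S : Finset (Fin d), (-1 : K) ^ (d - S.card) •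
    aeval (fun j : σ => ∑ i ∈ S, X (i, j)) P

/-- The non-classical rank (nc-rank) of `P` is at least `r`:
the Schmidt rank of `P̃` is at least `r`. -/
def ncRankGE {K : Type*} [CommRing K] {σ : Type*} (P : MvPolynomial σ K) (r : ℕ) : Prop :=
  SchmidtRankGE P.totalDegree (multiDiff P.totalDegree P) r

/-- The nc-rank of the collection `P̄` is at least `r`: every nontrivial linear combination
`P_ā = ∑ i, a_i P_i` has nc-rank at least `r`. -/
def ncRankCollGE {K : Type*} [CommRing K] {σ : Type*} {c : ℕ}
    (P : Fin c → MvPolynomial σ K) (r : ℕ) : Prop :=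
  ∀ a : Fin c → K, a ≠ 0 → ncRankGE (∑ i, C (a i) * P i) r

/-- A polynomial on `V_1 × ⋯ × V_d` (with `V_j = K^{n_j}`, variables indexed by
`(j : Fin d) × Fin (n j)`) is multilinear if every monomial in its support has degree
exactly one in the variables of each factor `V_j`; this says exactly that the associated
polynomial function is `K`-linear in each of the `d` arguments separately. -/
def IsMultilinearPoly {K : Type*} [CommRing K] {d : ℕ} {n : Fin d → ℕ}
    (P : MvPolynomial ((j : Fin d) × Fin (n j)) K) : Prop :=
  ∀ m ∈ P.support, ∀ j : Fin d, (∑ v : Fin (n j), m ⟨j, v⟩) = 1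

lemma aux_homMul {K σ : Type*} [Field K] (n : ℕ) (p q : MvPolynomial σ K) :
    homogeneousComponent n (p * q) =
      ∑ x ∈ Finset.HasAntidiagonal.antidiagonal n, homogeneousComponent x.1 p * homogeneousComponent x.2 q := by
  classical
  ext m
  simp only [coeff_sum, coeff_homogeneousComponent, coeff_mul]
  rw [Finset.sum_comm]
  have key : ∀ y ∈ Finset.HasAntidiagonal.antidiagonal m, ∑ x ∈ Finset.HasAntidiagonal.antidiagonal n,
      (if y.1.degree = x.1 then coeff y.1 p else 0) * (if y.2.degree = x.2 then coeff y.2 q else 0)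
      = if m.degree = n then coeff y.1 p * coeff y.2 q else 0 := by
    intro y hy
    rw [Finset.HasAntidiagonal.mem_antidiagonal] at hy
    have hd : m.degree = y.1.degree + y.2.degree := by rw [← hy, map_add]
    split_ifs with h
    · rw [Finset.sum_eq_single (y.1.degree, y.2.degree)]
      · simp
      · rintro ⟨a, b⟩ _ hne
        by_cases h1 : y.1.degree = a
        · by_cases h2 : y.2.degree = b
          · exact absurd (by rw [h1, h2]) hne
          · simp [h2]
        · simp [h1]
      · intro h'
        exact absurd (Finset.HasAntidiagonal.mem_antidiagonal.2 (by simp; omega)) h'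
    · refine Finset.sum_eq_zero fun x hx => ?_
      rw [Finset.HasAntidiagonal.mem_antidiagonal] at hx
      by_cases h1 : y.1.degree = x.1
      · rw [if_neg (show ¬ y.2.degree = x.2 by omega), mul_zero]
      · rw [if_neg h1, zero_mul]
  rw [Finset.sum_congr rfl key]
  split_ifs <;> simp

lemma aux_homMul0 {K σ : Type*} [Field K] (e : ℕ) (p q : MvPolynomial σ K)
    (hp : constantCoeff p = 0) (hq : constantCoeff q = 0) :
    homogeneousComponent (e + 1) (p * q) =
      ∑ i ∈ Finset.range e,
        homogeneousComponent (i + 1) p * homogeneousComponent (e - i) q := by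
  rw [aux_homMul, Finset.Nat.sum_antidiagonal_eq_sum_range_succ
    (fun i j => homogeneousComponent i p * homogeneousComponent j q)]
  rw [constantCoeff_eq] at hp hq
  rw [Finset.sum_range_succ, Finset.sum_range_succ']
  simp [homogeneousComponent_zero, hp, hq]

lemma aux_pow_order {K σ : Type*} [Field K] (β q : MvPolynomial σ K)
    (hβ : constantCoeff β = 0) (n : ℕ) :
    ∀ i < n, homogeneousComponent i (β ^ n * q) = 0 := by
  induction n with
  | zero => simp
  | succ n ih =>
    intro i hi
    rw [pow_succ', mul_assoc, aux_homMul]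
    refine Finset.sum_eq_zero fun x hx => ?_
    rw [Finset.HasAntidiagonal.mem_antidiagonal] at hx
    rcases Nat.eq_zero_or_pos x.1 with h | h
    · rw [h, homogeneousComponent_zero, ← constantCoeff_eq, hβ]; simp
    · rw [ih x.2 (by omega), mul_zero]

lemma aux_main_alg {K σ : Type*} [Field K] (e k : ℕ) (D α : MvPolynomial σ K)
    (Cs Ws : Fin k → MvPolynomial σ K) (h : α * D = ∑ s, Cs s * Ws s)
    (hα : constantCoeff α = 1) (hC : ∀ s, constantCoeff (Cs s) = 0)
    (hW : ∀ s, constantCoeff (Ws s) = 0) :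
    ∃ Q R : Fin (k * e) → MvPolynomial σ K,
      (∀ i, (Q i).totalDegree < e + 1) ∧ (∀ i, (R i).totalDegree < e + 1) ∧
      homogeneousComponent (e + 1) D = ∑ i, Q i * R i := by
  set u : MvPolynomial σ K := ∑ j ∈ Finset.range (e + 2), (1 - α) ^ j with hu
  have hD : D = ∑ s, Cs s * (u * Ws s) + (1 - α) ^ (e + 2) * D := by
    have h1 : α * u = 1 - (1 - α) ^ (e + 2) := by
      have := mul_neg_geom_sum (1 - α) (e + 2)
      rw [← hu] at this
      rw [← this]; ring
    have h2 : ∑ s, Cs s * (u * Ws s) = u * (α * D) := by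
      rw [h, Finset.mul_sum]
      exact Finset.sum_congr rfl fun s _ => by ring
    rw [h2]
    linear_combination D * (-h1)
  have key : homogeneousComponent (e + 1) D = ∑ s : Fin k, ∑ i : Fin e,
      homogeneousComponent (i + 1) (Cs s) * homogeneousComponent (e - i) (u * Ws s) := by
    conv_lhs => rw [hD]
    rw [map_add, aux_pow_order _ _ (by simp [hα]) _ _ (by omega), add_zero, map_sum]
    refine Finset.sum_congr rfl fun s _ => ?_
    rw [aux_homMul0 _ _ _ (hC s) (by simp [hW s]), Finset.sum_range]
  have hdeg : ∀ (n : ℕ) (p : MvPolynomial σ K), (homogeneousComponent n p).totalDegree ≤ n :=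
    fun n p => (homogeneousComponent_isHomogeneous n p).totalDegree_le
  refine ⟨fun i => homogeneousComponent ((finProdFinEquiv.symm i).2 + 1)
      (Cs (finProdFinEquiv.symm i).1),
    fun i => homogeneousComponent (e - (finProdFinEquiv.symm i).2)
      (u * Ws (finProdFinEquiv.symm i).1), fun i => ?_, fun i => ?_, ?_⟩
  · refine (hdeg _ _).trans_lt ?_
    have := (finProdFinEquiv.symm i).2.2
    omega
  · refine (hdeg _ _).trans_lt ?_
    omega
  · rw [key, ← Fintype.sum_prod_type']
    exact (Equiv.sum_comp finProdFinEquiv.symm (fun x : Fin k × Fin e =>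
      homogeneousComponent (x.2 + 1) (Cs x.1) * homogeneousComponent (e - x.2) (u * Ws x.1))).symm

/-- degree-lowering predicate -/
lemma aux_low_mul {K σ : Type*} [Field K] (p q : MvPolynomial σ K) (a b : ℕ)
    (hp : ∀ m : σ →₀ ℕ, a ≤ m.degree → coeff m p = 0)
    (hq : ∀ m : σ →₀ ℕ, b + 1 ≤ m.degree → coeff m q = 0) :
    ∀ m : σ →₀ ℕ, a + b ≤ m.degree → coeff m (p * q) = 0 := by
  classical
  intro m hm
  rw [coeff_mul]
  refine Finset.sum_eq_zero fun x hx => ?_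
  rw [Finset.HasAntidiagonal.mem_antidiagonal] at hx
  have : m.degree = x.1.degree + x.2.degree := by rw [← hx, map_add]
  rcases le_or_gt a x.1.degree with h | h
  · rw [hp _ h, zero_mul]
  · rw [hq _ (by omega), mul_zero]

lemma aux_mono_low {K σ : Type*} [Field K] (s : σ →₀ ℕ) (r : K) :
    ∀ m : σ →₀ ℕ, s.degree + 1 ≤ m.degree → coeff m (monomial s r) = 0 := by
  classical
  intro m hm
  rw [coeff_monomial, if_neg]
  rintro rfl
  omega

lemma aux_trans_mono {K σ : Type*} [Field K] (x : σ → K) (s : σ →₀ ℕ) :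
    ∀ m : σ →₀ ℕ, s.degree ≤ m.degree →
      coeff m (aeval (fun i => X i + C (x i)) (monomial s (1 : K)) - monomial s 1) = 0 := by
  classical
  have hadd : ∀ s t : σ →₀ ℕ,
      (∀ m : σ →₀ ℕ, s.degree ≤ m.degree →
        coeff m (aeval (fun i => X i + C (x i)) (monomial s (1 : K)) - monomial s 1) = 0) →
      (∀ m : σ →₀ ℕ, t.degree ≤ m.degree →
        coeff m (aeval (fun i => X i + C (x i)) (monomial t (1 : K)) - monomial t 1) = 0) →
      (∀ m : σ →₀ ℕ, (s + t).degree ≤ m.degree →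
        coeff m (aeval (fun i => X i + C (x i)) (monomial (s + t) (1 : K))
          - monomial (s + t) 1) = 0) := by
    intro s t hs ht m hm
    rw [map_add] at hm
    have e1 : monomial (s + t) (1 : K) = monomial s 1 * monomial t 1 := by
      rw [monomial_mul, one_mul]
    rw [e1, map_mul]
    set f := aeval (fun i => X i + C (x i)) (monomial s (1 : K)) with hf
    set g := aeval (fun i => X i + C (x i)) (monomial t (1 : K)) with hg
    have e2 : f * g - monomial s 1 * monomial t 1 =
      (f - monomial s 1) * g + (g - monomial t 1) * monomial s 1 := by ring
    rw [e2, coeff_add, aux_low_mul _ _ _ _ hs _ m hm,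
      aux_low_mul _ _ _ _ ht (aux_mono_low s 1) m (by omega), add_zero]
    intro m' hm'
    have h3 := ht m' (by omega)
    rw [coeff_sub, aux_mono_low t 1 m' hm', sub_zero] at h3
    exact h3
  induction s using Finsupp.induction_linear with
  | zero => intro m _; simp
  | add s t hs ht => exact hadd s t hs ht
  | single i n =>
    induction n with
    | zero => intro m _; simp
    | succ n ih =>
      rw [Finsupp.single_add]
      refine hadd _ _ ih ?_
      intro m hm
      have e1 : (monomial (Finsupp.single i 1) (1 : K)) = X i := rfl
      rw [e1, aeval_X, add_sub_cancel_left, coeff_C, if_neg]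
      rintro rfl
      simp at hm

lemma aux_trans_hom {K σ : Type*} [Field K] (x : σ → K) (n : ℕ) (p : MvPolynomial σ K)
    (hp : p.IsHomogeneous n) :
    homogeneousComponent n (aeval (fun i => X i + C (x i)) p) = p := by
  classical
  suffices h : homogeneousComponent n (aeval (fun i => X i + C (x i)) p - p) = 0 by
    rw [map_sub, homogeneousComponent_eq_self hp, sub_eq_zero] at h
    exact h
  have e : aeval (fun i => X i + C (x i)) p - p = ∑ s ∈ p.support,
      C (coeff s p) * (aeval (fun i => X i + C (x i)) (monomial s (1 : K)) - monomial s 1) := by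
    conv_lhs => rw [p.as_sum]
    rw [map_sum, ← Finset.sum_sub_distrib]
    refine Finset.sum_congr rfl fun s _ => ?_
    have : monomial s (coeff s p) = C (coeff s p) * monomial s (1 : K) := by
      rw [C_mul_monomial, mul_one]
    rw [this, map_mul, mul_sub, aeval_C]
    rfl
  rw [e, map_sum]
  refine Finset.sum_eq_zero fun s hs => ?_
  ext m
  rw [coeff_homogeneousComponent]
  split_ifs with hm
  · rw [coeff_C_mul, aux_trans_mono, mul_zero, coeff_zero]
    have : s.degree = n := by
      have := hp (mem_support_iff.1 hs)
      rw [← this, Finsupp.degree_eq_weight_one]; rfl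
    omega
  · simp

lemma aux_trans_const {K σ : Type*} [Field K] (x : σ → K) (p : MvPolynomial σ K) :
    constantCoeff (aeval (fun i => X i + C (x i)) p) = eval x p := by
  have : (constantCoeff.comp (aeval (fun i => X i + C (x i)) :
      MvPolynomial σ K →ₐ[K] MvPolynomial σ K).toRingHom) = eval x := by
    apply MvPolynomial.ringHom_ext <;> intros <;> simp
  exact congrArg (fun f => f p) this

open Matrix in
lemma aux_LA {K : Type*} [Field K] {c N : ℕ} (M : Matrix (Fin c) (Fin N) K) (hM : M.rank < c) :
    ∃ (U : Matrix (Fin M.rank) (Fin c) K) (Y : Matrix (Fin N) (Fin M.rank) K) (a : Fin c → K),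
      U * M * Y = 1 ∧ a ≠ 0 ∧ a ᵥ* M = 0 := by
  classical
  let W := LinearMap.range M.mulVecLin
  have hW : Module.finrank K W = M.rank := rfl
  let b := Module.finBasisOfFinrankEq K W hW
  let f : (Fin M.rank → K) →ₗ[K] (Fin c → K) := W.subtype ∘ₗ b.equivFun.symm.toLinearMap
  have hf : LinearMap.ker f = ⊥ := by
    rw [LinearMap.ker_eq_bot]
    exact Subtype.val_injective.comp b.equivFun.symm.injective
  obtain ⟨g, hg⟩ := LinearMap.exists_leftInverse_of_injective f hf
  have hy : ∀ s, ∃ y, M *ᵥ y = (b s : Fin c → K) := fun s => (b s).2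
  choose y hy using hy
  have hlt : W < ⊤ := by
    rw [lt_top_iff_ne_top]
    intro h
    have : Module.finrank K W = c := by rw [h]; simp
    omega
  obtain ⟨φ, hφ0, hφ⟩ := W.exists_le_ker_of_lt_top hlt
  refine ⟨LinearMap.toMatrix' g, (Matrix.of y)ᵀ, fun i => φ (Pi.single i 1), ?_, ?_, ?_⟩
  · have h1 : ∀ s, (LinearMap.toMatrix' g * M * (Matrix.of y)ᵀ) *ᵥ Pi.single s 1
        = Pi.single s 1 := by
      intro s
      rw [← Matrix.mulVec_mulVec, ← Matrix.mulVec_mulVec]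
      have : (Matrix.of y)ᵀ *ᵥ Pi.single s 1 = y s := by
        ext j; simp
      rw [this, hy, LinearMap.toMatrix'_mulVec]
      have h2 : f (Pi.single s 1) = b s := by simp [f]
      rw [← h2]
      exact congrArg (fun h => h (Pi.single s 1)) hg
    ext i s
    have := congrFun (h1 s) i
    simpa [Matrix.one_apply, Pi.single_apply] using this
  · intro h
    apply hφ0
    apply LinearMap.pi_ext'
    intro i
    ext
    simpa using congrFun h i
  · ext v
    have h1 : M *ᵥ Pi.single v 1 ∈ W := ⟨Pi.single v 1, rfl⟩
    have h2 := hφ h1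
    rw [LinearMap.mem_ker] at h2
    have h3 : M *ᵥ Pi.single v 1 = ∑ i, M i v • (Pi.single i (1 : K) : Fin c → K) := by
      ext j; simp [Pi.single_apply, Finset.sum_apply]
    rw [h3, map_sum] at h2
    simp only [map_smul, smul_eq_mul] at h2
    simp only [Matrix.vecMul, dotProduct, Pi.zero_apply]
    rw [← h2]
    exact Finset.sum_congr rfl fun _ _ => mul_comm _ _

open Matrix in
lemma aux_LA2 {K : Type*} [Field K] {c N k : ℕ} (g : Matrix (Fin c) (Fin N) K)
    (hg : g.rank ≤ k) (U : Matrix (Fin k) (Fin c) K) (Y : Matrix (Fin N) (Fin k) K)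
    (a : Fin c → K) (y : Fin N → K) :
    (U * g * Y).det * ((U * g * Y).det * (a ⬝ᵥ (g *ᵥ y)) -
      ((a ᵥ* g) ᵥ* Y) ⬝ᵥ ((U * g * Y).adjugate *ᵥ (U *ᵥ (g *ᵥ y)))) = 0 := by
  by_cases hdet : (U * g * Y).det = 0
  · rw [hdet, zero_mul]
  have hr : (U * g * Y).rank = k := by
    have := Matrix.rank_of_isUnit (U * g * Y)
      ((Matrix.isUnit_iff_isUnit_det _).2 (isUnit_iff_ne_zero.2 hdet))
    simpa using this
  have hr2 : k ≤ (U * g).rank := hr.symm.le.trans (Matrix.rank_mul_le_left (U * g) Y)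
  have hle : LinearMap.range (U * g)ᵀ.mulVecLin ≤ LinearMap.range gᵀ.mulVecLin := by
    rintro _ ⟨z, rfl⟩
    refine ⟨Uᵀ *ᵥ z, ?_⟩
    rw [Matrix.mulVecLin_apply, Matrix.mulVecLin_apply, Matrix.transpose_mul,
      Matrix.mulVec_mulVec]
  have heq : LinearMap.range (U * g)ᵀ.mulVecLin = LinearMap.range gᵀ.mulVecLin := by
    refine Submodule.eq_of_le_of_finrank_le hle ?_
    have h1 : Module.finrank K (LinearMap.range gᵀ.mulVecLin) = g.rank := Matrix.rank_transpose g
    have h2 : Module.finrank K (LinearMap.range (U * g)ᵀ.mulVecLin) = (U * g).rank :=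
      Matrix.rank_transpose (U * g)
    omega
  have hmem : gᵀ *ᵥ a ∈ LinearMap.range (U * g)ᵀ.mulVecLin := by
    rw [heq]; exact ⟨a, rfl⟩
  obtain ⟨l, hl⟩ := hmem
  have hl' : a ᵥ* g = l ᵥ* (U * g) := by
    rw [Matrix.mulVecLin_apply, Matrix.mulVec_transpose, Matrix.mulVec_transpose] at hl
    exact hl.symm
  have e1 : a ⬝ᵥ (g *ᵥ y) = l ⬝ᵥ (U *ᵥ (g *ᵥ y)) := by
    rw [Matrix.dotProduct_mulVec, hl', ← Matrix.dotProduct_mulVec, Matrix.mulVec_mulVec]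
  have e2 : ((a ᵥ* g) ᵥ* Y) ⬝ᵥ ((U * g * Y).adjugate *ᵥ (U *ᵥ (g *ᵥ y))) =
      (U * g * Y).det * (l ⬝ᵥ (U *ᵥ (g *ᵥ y))) := by
    rw [hl', Matrix.vecMul_vecMul, ← Matrix.dotProduct_mulVec, Matrix.mulVec_mulVec,
      Matrix.mul_adjugate, Matrix.smul_mulVec, Matrix.one_mulVec, dotProduct_smul, smul_eq_mul]
  rw [e1, e2, sub_self, mul_zero]

/-- indicator weight of the block `e` -/
def auxW {d : ℕ} {n : Fin d → ℕ} (e : Fin d) (i : (j : Fin d) × Fin (n j)) : ℕ :=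
  if i.1 = e then 1 else 0

lemma auxW_weight {d : ℕ} {n : Fin d → ℕ} (e : Fin d) (m : ((j : Fin d) × Fin (n j)) →₀ ℕ) :
    Finsupp.weight (auxW e) m = ∑ v : Fin (n e), m ⟨e, v⟩ := by
  rw [Finsupp.weight_apply, Finsupp.sum_fintype _ _ (by simp), Fintype.sum_sigma,
    Finset.sum_eq_single e]
  · simp [auxW]
  · intro b _ hb
    simp [auxW, hb]
  · simp

lemma aux_wh {K : Type*} [Field K] {d : ℕ} {n : Fin d → ℕ} (e : Fin d)
    (P : MvPolynomial ((j : Fin d) × Fin (n j)) K) (hP : IsMultilinearPoly P) :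
    P.IsWeightedHomogeneous (auxW e) 1 := by
  intro m hm
  rw [auxW_weight]
  exact hP m (mem_support_iff.2 hm) e

lemma aux_hom {K : Type*} [Field K] {d : ℕ} {n : Fin d → ℕ}
    (P : MvPolynomial ((j : Fin d) × Fin (n j)) K) (hP : IsMultilinearPoly P) :
    P.IsHomogeneous d := by
  intro m hm
  have h1 : Finsupp.weight 1 m = m.degree := by rw [Finsupp.degree_eq_weight_one]; rfl
  rw [h1, Finsupp.degree_eq_sum, Fintype.sum_sigma,
    Finset.sum_congr rfl fun j _ => hP m (mem_support_iff.2 hm) j]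
  simp

lemma aux_euler {K : Type*} [Field K] {d : ℕ} {n : Fin d → ℕ} (e : Fin d)
    (P : MvPolynomial ((j : Fin d) × Fin (n j)) K) (hP : IsMultilinearPoly P) :
    P = ∑ v : Fin (n e), pderiv ⟨e, v⟩ P * X ⟨e, v⟩ := by
  have h := (aux_wh e P hP).sum_weight_X_mul_pderiv
  rw [one_smul] at h
  conv_lhs => rw [← h]
  rw [Fintype.sum_sigma, Finset.sum_eq_single e]
  · simp [auxW, mul_comm]
  · intro b _ hb
    simp [auxW, hb]
  · simp

lemma aux_indep {K : Type*} [Field K] {d : ℕ} {n : Fin d → ℕ} (e : Fin d)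
    (P : MvPolynomial ((j : Fin d) × Fin (n j)) K) (hP : IsMultilinearPoly P) (v : Fin (n e))
    (x y : ((j : Fin d) × Fin (n j)) → K) (hxy : ∀ i, i.1 ≠ e → x i = y i) :
    eval x (pderiv ⟨e, v⟩ P) = eval y (pderiv ⟨e, v⟩ P) := by
  have h : (pderiv ⟨e, v⟩ P).IsWeightedHomogeneous (auxW e) 0 :=
    (aux_wh e P hP).pderiv (by simp [auxW])
  rw [eval_eq', eval_eq']
  refine Finset.sum_congr rfl fun m hm => ?_
  congr 1
  refine Finset.prod_congr rfl fun i _ => ?_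
  by_cases hi : i.1 = e
  · have h0 := h (mem_support_iff.1 hm)
    rw [auxW_weight, Finset.sum_eq_zero_iff] at h0
    obtain ⟨j, w⟩ := i
    obtain rfl : j = e := hi
    rw [h0 w (Finset.mem_univ _), pow_zero, pow_zero]
  · rw [hxy i hi]

open Matrix in
lemma aux_poly_id {K σ : Type*} [Field K] [Infinite K] {c N k : ℕ}
    (G : Matrix (Fin c) (Fin N) (MvPolynomial σ K)) (x0 : σ → K)
    (hG : ∀ x : σ → K, (G.map (eval x)).rank ≤ k) (U : Matrix (Fin k) (Fin c) K)
    (Y : Matrix (Fin N) (Fin k) K) (hx0 : U * G.map (eval x0) * Y = 1)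
    (a : Fin c → K) (y : Fin N → MvPolynomial σ K) :
    ((U.map (C (σ := σ)) * G * Y.map (C (σ := σ))).det * ((C ∘ a) ⬝ᵥ (G *ᵥ y)) =
      (((C ∘ a) ᵥ* G) ᵥ* Y.map (C (σ := σ))) ⬝ᵥ
        ((U.map (C (σ := σ)) * G * Y.map (C (σ := σ))).adjugate *ᵥ (U.map (C (σ := σ)) *ᵥ (G *ᵥ y)))) := by
  have hU : ∀ x : σ → K, (U.map (C (σ := σ))).map (eval x) = U := fun x => by ext; simp
  have hY : ∀ x : σ → K, (Y.map (C (σ := σ))).map (eval x) = Y := fun x => by ext; simp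
  have ha : ∀ x : σ → K, (eval x) ∘ (C ∘ a) = a := fun x => by ext; simp
  have hA : ∀ x : σ → K, (U.map (C (σ := σ)) * G * Y.map (C (σ := σ))).map (eval x) = U * G.map (eval x) * Y := by
    intro x
    rw [Matrix.map_mul, Matrix.map_mul, hU, hY]
  have hdet : ∀ x : σ → K,
      eval x (U.map (C (σ := σ)) * G * Y.map (C (σ := σ))).det = (U * G.map (eval x) * Y).det := by
    intro x
    rw [RingHom.map_det, RingHom.mapMatrix_apply, hA]
  have hne : (U.map (C (σ := σ)) * G * Y.map (C (σ := σ))).det ≠ 0 := by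
    intro h
    have := hdet x0
    rw [h, hx0] at this
    simp at this
  rw [← sub_eq_zero]
  refine (mul_eq_zero.1 (?_ : (U.map (C (σ := σ)) * G * Y.map (C (σ := σ))).det * _ = 0)).resolve_left hne
  apply MvPolynomial.funext
  intro x
  have := aux_LA2 (G.map (eval x)) (hG x) U Y a ((eval x) ∘ y)
  rw [map_zero, ← this, map_mul, map_sub, map_mul, hdet]
  have hmv : ∀ {p q : ℕ} (M : Matrix (Fin p) (Fin q) (MvPolynomial σ K))
      (w : Fin q → MvPolynomial σ K), (eval x) ∘ (M *ᵥ w) = M.map (eval x) *ᵥ ((eval x) ∘ w) := by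
    intro p q M w
    ext i
    exact RingHom.map_mulVec (eval x) M w i
  have hvm : ∀ {p q : ℕ} (M : Matrix (Fin p) (Fin q) (MvPolynomial σ K))
      (w : Fin p → MvPolynomial σ K), (eval x) ∘ (w ᵥ* M) = ((eval x) ∘ w) ᵥ* M.map (eval x) := by
    intro p q M w
    ext i
    exact RingHom.map_vecMul (eval x) M w i
  have hadj : (U.map (C (σ := σ)) * G * Y.map (C (σ := σ))).adjugate.map (eval x) =
      (U * G.map (eval x) * Y).adjugate := by
    rw [← hA]
    exact RingHom.map_adjugate (eval x) _
  rw [RingHom.map_dotProduct, RingHom.map_dotProduct, hvm, hvm, hmv, hmv, hmv, hmv, hadj, hU, hY, ha]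

/-- For every `c ≥ 1` and `d ≥ 1` there is a constant `r = r(c,d)` such that:
for every infinite field `K`, finite-dimensional `K`-vector spaces `V_1,...,V_d`
(`V_j = K^{n_j}`), and every collection `P̄ = (P_1,...,P_c)` of multilinear functions
`P_i : V_1 × ⋯ × V_d → K` whose Schmidt rank (as degree-`d` polynomials) is `≥ r`, for
every `t̄ ∈ K^c` there exists `v ∈ V_1 × ⋯ × V_d` with `P_i(v) = t_i` for all `i`. -/
theorem stmt5 (c d : ℕ) (hc : 1 ≤ c) (hd : 1 ≤ d) :
    ∃ r : ℕ, ∀ (K : Type) [Field K] [Infinite K] (n : Fin d → ℕ)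
      (P : Fin c → MvPolynomial ((j : Fin d) × Fin (n j)) K),
      (∀ i, IsMultilinearPoly (P i)) →
      (∀ a : Fin c → K, a ≠ 0 → SchmidtRankGE d (∑ i, C (a i) * P i) r) →
      ∀ t : Fin c → K,
        ∃ x : ((j : Fin d) × Fin (n j)) → K, ∀ i, eval x (P i) = t i := by

  classical
  refine ⟨c * d, ?_⟩
  intro K _ _ n P hP hrank t
  obtain ⟨e, rfl⟩ : ∃ e, d = e + 1 := ⟨d - 1, by omega⟩
  let l : Fin (e + 1) := Fin.last e
  let G : Matrix (Fin c) (Fin (n l)) (MvPolynomial ((j : Fin (e + 1)) × Fin (n j)) K) :=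
    Matrix.of fun i v => pderiv ⟨l, v⟩ (P i)
  let y : Fin (n l) → MvPolynomial ((j : Fin (e + 1)) × Fin (n j)) K := fun v => X ⟨l, v⟩
  have hGy : G.mulVec y = P := by
    ext1 i
    exact (aux_euler l (P i) (hP i)).symm
  have hind : ∀ x x' : ((j : Fin (e + 1)) × Fin (n j)) → K, (∀ i, i.1 ≠ l → x i = x' i) →
      G.map (eval x) = G.map (eval x') := by
    intro x x' h
    ext i v
    exact aux_indep l (P i) (hP i) v x x' h
  have hev : ∀ x : ((j : Fin (e + 1)) × Fin (n j)) → K, ∀ i,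
      eval x (P i) = ((G.map (eval x)).mulVec fun v => x ⟨l, v⟩) i := by
    intro x i
    conv_lhs => rw [← hGy]
    rw [RingHom.map_mulVec]
    have : (eval x) ∘ y = fun v => x ⟨l, v⟩ := by ext v; simp [y]
    rw [this]
  -- point of maximal rank
  have hbdd : ∀ x : ((j : Fin (e + 1)) × Fin (n j)) → K, (G.map (eval x)).rank ≤ c := fun x => by
    simpa using (G.map (eval x)).rank_le_height
  obtain ⟨x1, hx1⟩ : ∃ x1 : ((j : Fin (e + 1)) × Fin (n j)) → K,
      ∀ x, (G.map (eval x)).rank ≤ (G.map (eval x1)).rank := by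
    have hfin : (Set.range fun x : ((j : Fin (e + 1)) × Fin (n j)) → K =>
        (G.map (eval x)).rank).Finite :=
      (Set.finite_Iic c).subset (by rintro _ ⟨x, rfl⟩; exact hbdd x)
    obtain ⟨_, ⟨x1, rfl⟩, h⟩ := hfin.exists_maximal (Set.range_nonempty _) |>.imp
      fun m hm => (⟨hm.1, hm.2⟩ : _ ∧ _)
    refine ⟨x1, fun x => ?_⟩
    rcases le_total (G.map (eval x)).rank (G.map (eval x1)).rank with h' | h'
    · exact h'
    · exact h ⟨x, rfl⟩ h'
  let x0 : ((j : Fin (e + 1)) × Fin (n j)) → K := fun i => if i.1 = l then 0 else x1 i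
  have hx01 : G.map (eval x0) = G.map (eval x1) := hind _ _ fun i hi => by simp [x0, hi]
  have hx0 : ∀ x, (G.map (eval x)).rank ≤ (G.map (eval x0)).rank := by rw [hx01]; exact hx1
  by_cases hk : (G.map (eval x0)).rank < c
  · exfalso
    obtain ⟨U, Y, a, hU, ha0, ha⟩ := aux_LA _ hk
    have hid := aux_poly_id G x0 hx0 U Y hU a y
    rw [hGy] at hid
    have hPx0 : ∀ i, eval x0 (P i) = 0 := by
      intro i
      rw [hev]
      have : (fun v => x0 ⟨l, v⟩) = 0 := by ext v; simp [x0]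
      rw [this, Matrix.mulVec_zero]; rfl
    have hD : dotProduct (C ∘ a) P = ∑ i, C (a i) * P i := rfl
    have hhom : (∑ i, C (a i) * P i).IsHomogeneous (e + 1) :=
      IsHomogeneous.sum _ _ _ fun i _ => by
        simpa using (isHomogeneous_C _ (a i)).mul (aux_hom (P i) (hP i))
    rw [hD] at hid
    have hid2 := congrArg (aeval (fun i => X i + C (x0 i))) hid
    rw [map_mul, dotProduct] at hid2
    conv at hid2 =>
      rhs
      rw [map_sum]
    simp only [map_mul] at hid2
    have hmain := aux_main_alg e _ _ _ _ _ hid2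
    have hmain2 := hmain ?_ ?_ ?_
    · obtain ⟨Q, R, hQ, hR, hQR⟩ := hmain2
      rw [aux_trans_hom _ _ _ hhom] at hQR
      have := hrank a ha0 _ Q R hQ hR hQR
      have h2 := Nat.mul_le_mul_right e hk.le
      have h3 : c * (e + 1) = c * e + c := by ring
      omega
    · rw [aux_trans_const, RingHom.map_det, RingHom.mapMatrix_apply, Matrix.map_mul,
        Matrix.map_mul]
      have e1 : (U.map C).map (eval x0) = U := by ext; simp
      have e2 : (Y.map C).map (eval x0) = Y := by ext; simp
      rw [e1, e2, hU, Matrix.det_one]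
    · intro s
      rw [aux_trans_const, RingHom.map_vecMul]
      have e1 : (eval x0) ∘ (Matrix.vecMul (C ∘ a) G) = 0 := by
        ext v
        have e2 : (eval x0) ∘ (C ∘ a) = a := by ext; simp
        rw [Function.comp_apply, RingHom.map_vecMul, e2, ha]
      rw [e1, Matrix.zero_vecMul]; rfl
    · intro s
      rw [aux_trans_const, RingHom.map_mulVec]
      have e1 : (eval x0) ∘ ((U.map C).mulVec P) = 0 := by
        ext v
        have e2 : (eval x0) ∘ P = 0 := by ext i; exact hPx0 i
        rw [Function.comp_apply, RingHom.map_mulVec, e2, Matrix.mulVec_zero]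
      rw [e1, Matrix.mulVec_zero]; rfl
  · have hrk : (G.map (eval x0)).rank = c := le_antisymm (hbdd x0) (not_lt.1 hk)
    have htop : LinearMap.range (G.map (eval x0)).mulVecLin = ⊤ := by
      apply Submodule.eq_top_of_finrank_eq
      rw [Module.finrank_fin_fun]
      exact hrk
    obtain ⟨z, hz⟩ : t ∈ LinearMap.range (G.map (eval x0)).mulVecLin := htop ▸ Submodule.mem_top
    let x : ((j : Fin (e + 1)) × Fin (n j)) → K := fun i =>
      if h : i.1 = l then z (h ▸ i.2) else x0 i
    refine ⟨x, fun i => ?_⟩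
    rw [hev, hind x x0 fun i hi => by simp [x, hi]]
    have : (fun v => x ⟨l, v⟩) = z := by ext v; simp [x]
    rw [this, ← hz]; rfl
end

section
/- Fix d ≥ 1 and m ≥ 1. Let K be a field, W = K^d with coordinates x^1,...,x^d, μ : W → K the product μ(x^1,...,x^d) = Π_{j=1}^d x^j, V_m = W^m, and Q_m : V_m → K the polynomial Q_m(w_1,...,w_m) = Σ_{i=1}^m μ(w_i). Then the nc-rank of Q_m is at least m. -/
open MvPolynomial

theorem height_maximal_mv {K : Type*} [Field K] (σ : Type*) [Finite σ] :
    ∀ M : Ideal (MvPolynomial σ K), M.IsMaximal → M.height = Nat.card σ := by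
  induction σ using Finite.induction_empty_option with
  | of_equiv e H =>
    intro M hM
    have := (renameEquiv K e).toRingEquiv.height_comap M
    rw [← this, ← Nat.card_congr e]
    apply H
    exact Ideal.comap_isMaximal_of_equiv (renameEquiv K e).toRingEquiv
  | h_empty =>
    intro M hM
    simp only [Nat.card_eq_fintype_card, Fintype.card_pempty, Nat.cast_zero]
    have h0 : ringKrullDim (MvPolynomial PEmpty K) = 0 := by simp
    have := Ideal.height_le_ringKrullDim_of_ne_top hM.ne_top
    rw [h0] at this
    exact le_antisymm (by exact_mod_cast this) bot_le
  | @h_option α _ IH =>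
    intro M hM
    let e := (MvPolynomial.optionEquivLeft K α).toRingEquiv
    rw [← e.symm.height_comap M]
    have h1 : (M.comap e.symm).IsMaximal := Ideal.comap_isMaximal_of_equiv e.symm
    set P := M.comap e.symm
    have h2 : (P.under (MvPolynomial α K)).IsMaximal :=
      Polynomial.isMaximal_comap_C_of_isJacobsonRing P
    have h3 : P.LiesOver (P.under (MvPolynomial α K)) := ⟨rfl⟩
    rw [Polynomial.height_eq_height_add_one (P.under _) P, IH _ h2]
    simp

noncomputable def lowDeg {K : Type*} [Field K] {σ : Type*} (J : Ideal (MvPolynomial σ K)) (n : ℕ) :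
    Submodule K (MvPolynomial σ K) := J.restrictScalars K ⊔ restrictTotalDegree σ K n

section
variable {K : Type*} [Field K] {σ : Type*} {J : Ideal (MvPolynomial σ K)}

theorem lowDeg_of_mem {n : ℕ} {p : MvPolynomial σ K} (h : p ∈ J) : p ∈ lowDeg J n :=
  (le_sup_left : _ ≤ lowDeg J n) (by simpa using h)

theorem lowDeg_of_deg {n : ℕ} {p : MvPolynomial σ K} (h : p.totalDegree ≤ n) : p ∈ lowDeg J n :=
  (le_sup_right : _ ≤ lowDeg J n) ((mem_restrictTotalDegree _ _ _).2 h)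

theorem lowDeg_mul {n k : ℕ} {p q : MvPolynomial σ K} (h : p ∈ lowDeg J n)
    (hq : q.totalDegree ≤ k) : p * q ∈ lowDeg J (n + k) := by
  obtain ⟨a, ha, b, hb, rfl⟩ := Submodule.mem_sup.1 h
  rw [add_mul]
  refine Submodule.add_mem _ (lowDeg_of_mem (J.mul_mem_right _ (by simpa using ha)))
    (lowDeg_of_deg ((totalDegree_mul _ _).trans ?_))
  have := (mem_restrictTotalDegree _ _ _).1 hb
  omega

theorem lowDeg_mono {n k : ℕ} (h : n ≤ k) : lowDeg J n ≤ lowDeg J k := by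
  apply sup_le_sup_left
  intro p hp
  rw [mem_restrictTotalDegree] at *
  omega

theorem totalDegree_pderiv_le' (p : MvPolynomial σ K) (j : σ) :
    (pderiv j p).totalDegree ≤ p.totalDegree - 1 := by
  classical
  conv_lhs => rw [p.as_sum, map_sum]
  refine (totalDegree_finsetSum _ _).trans (Finset.sup_le fun s hs => ?_)
  rw [pderiv_monomial]
  by_cases h : s j = 0
  · simp [h]
  refine (totalDegree_monomial_le _ _).trans ?_
  have h1 := le_totalDegree hs
  have h2 : (s - Finsupp.single j 1) + Finsupp.single j 1 = s := by
    ext k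
    by_cases hk : k = j
    · subst hk; simp; omega
    · simp [hk]
  have h3 : ((s - Finsupp.single j 1) + Finsupp.single j 1).degree = s.degree := by rw [h2]
  rw [map_add, Finsupp.degree_single] at h3
  change s.degree ≤ _ at h1
  change (s - Finsupp.single j 1).degree ≤ _
  omega

theorem totalDegree_aeval_le' {τ : Type*} (f : τ → MvPolynomial σ K)
    (hf : ∀ i, (f i).totalDegree ≤ 1) (p : MvPolynomial τ K) :
    (aeval f p).totalDegree ≤ p.totalDegree := by
  classical
  conv_lhs => rw [p.as_sum, map_sum]
  refine (totalDegree_finsetSum _ _).trans (Finset.sup_le fun s hs => ?_)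
  rw [aeval_monomial]
  refine (totalDegree_mul _ _).trans ?_
  have h1 := le_totalDegree hs
  have : (algebraMap K (MvPolynomial σ K) (coeff s p)).totalDegree = 0 := totalDegree_C _
  rw [this, zero_add]
  refine le_trans ?_ h1
  refine (totalDegree_finsetProd _ _).trans (Finset.sum_le_sum fun i _ => ?_)
  refine (totalDegree_pow _ _).trans ?_
  simpa using Nat.mul_le_mul_left (s i) (hf i)

theorem lowDeg_top [Fintype σ] {d : ℕ} (hd : 1 ≤ d)
    (hX : ∀ j : σ, (X j : MvPolynomial σ K) ^ d ∈ lowDeg J (d - 1)) :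
    lowDeg J (Fintype.card σ * (d - 1)) = ⊤ := by
  classical
  set M := Fintype.card σ * (d - 1) with hM
  have key : ∀ N, lowDeg J N ≤ lowDeg J M := by
    intro N
    induction N with
    | zero => exact lowDeg_mono (Nat.zero_le _)
    | succ N ih =>
      by_cases hN : N + 1 ≤ M
      · exact lowDeg_mono hN
      refine le_trans ?_ ih
      refine sup_le le_sup_left ?_
      intro p hp
      rw [mem_restrictTotalDegree] at hp
      rw [p.as_sum]
      refine Submodule.sum_mem _ fun s hs => ?_
      have h1 : s.degree ≤ N + 1 := (le_totalDegree hs).trans hp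
      by_cases h2 : s.degree ≤ N
      · exact lowDeg_of_deg ((totalDegree_monomial_le _ _).trans h2)
      obtain ⟨j, hj⟩ : ∃ j, d ≤ s j := by
        by_contra hcon
        push Not at hcon
        have : s.degree ≤ M := by
          rw [Finsupp.degree_eq_sum]
          calc ∑ i, s i ≤ ∑ i : σ, (d - 1) :=
                Finset.sum_le_sum fun i _ => by have := hcon i; omega
            _ = M := by simp [hM]
        omega
      have h3 : Finsupp.single j d + (s - Finsupp.single j d) = s := by
        ext k
        by_cases hk : k = j
        · subst hk; simp; omega
        · simp [Ne.symm hk]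
      have h4 : (Finsupp.single j d + (s - Finsupp.single j d)).degree = s.degree := by rw [h3]
      rw [map_add, Finsupp.degree_single] at h4
      have h5 : monomial s (coeff s p) =
          X j ^ d * monomial (s - Finsupp.single j d) (coeff s p) := by
        rw [X_pow_eq_monomial, monomial_mul, h3, one_mul]
      rw [h5]
      refine lowDeg_mono ?_ (lowDeg_mul (k := (s - Finsupp.single j d).degree) (hX j)
        (totalDegree_monomial_le _ _))
      omega
  exact eq_top_iff.2 fun p _ => key p.totalDegree (lowDeg_of_deg le_rfl)

theorem card_le_of_finite [Fintype σ] {d : ℕ} (hd : 1 ≤ d) {ι : Type*} [Fintype ι]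
    (g : ι → MvPolynomial σ K) (hne : Ideal.span (Set.range g) ≠ ⊤)
    (hX : ∀ j : σ, (X j : MvPolynomial σ K) ^ d ∈ lowDeg (Ideal.span (Set.range g)) (d - 1)) :
    Fintype.card σ ≤ Fintype.card ι := by
  classical
  set J := Ideal.span (Set.range g) with hJ
  obtain ⟨p, hp⟩ := Ideal.nonempty_minimalPrimes hne
  have hprime : p.IsPrime := hp.1.1
  have hJp : J ≤ p := hp.1.2
  have htop := lowDeg_top hd hX
  have hfin : Module.Finite K (MvPolynomial σ K ⧸ p) := by
    let f : restrictTotalDegree σ K (Fintype.card σ * (d - 1)) →ₗ[K] (MvPolynomial σ K ⧸ p) :=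
      (Ideal.Quotient.mkₐ K p).toLinearMap ∘ₗ Submodule.subtype _
    apply Module.Finite.of_surjective f
    intro x
    obtain ⟨x, rfl⟩ := Ideal.Quotient.mk_surjective x
    have hx : x ∈ lowDeg J (Fintype.card σ * (d - 1)) := by rw [htop]; trivial
    obtain ⟨a, ha, b, hb, rfl⟩ := Submodule.mem_sup.1 hx
    refine ⟨⟨b, hb⟩, ?_⟩
    have : Ideal.Quotient.mk p a = 0 := Ideal.Quotient.eq_zero_iff_mem.2 (hJp (by simpa using ha))
    simp [f, this]
  have hmax : p.IsMaximal := by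
    apply Ideal.Quotient.maximal_of_isField
    exact isField_of_isIntegral_of_isField' (R := K) (Field.toIsField K)
  have h1 := height_maximal_mv σ p hmax
  have h2 : p.height ≤ (Finset.univ.image g).card := by
    apply Ideal.height_le_card_of_mem_minimalPrimes_span_finset
    simpa using hp
  rw [h1] at h2
  have h3 : (Finset.univ.image g).card ≤ Fintype.card ι := Finset.card_image_le
  have h4 : Nat.card σ ≤ (Finset.univ.image g).card := by exact_mod_cast h2
  rw [Nat.card_eq_fintype_card] at h4
  omega
end

theorem pderiv_prod_zero {K : Type*} [Field K] {σ τ : Type*} (j : σ) (f : τ → σ) (s : Finset τ)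
    (h : ∀ l ∈ s, f l ≠ j) : pderiv j (∏ l ∈ s, (X (f l) : MvPolynomial σ K)) = 0 := by
  classical
  induction s using Finset.induction_on with
  | empty => simp
  | insert a s ha ih =>
    rw [Finset.prod_insert ha, pderiv_mul, ih fun l hl => h l (Finset.mem_insert_of_mem hl),
      pderiv_X_of_ne (h a (Finset.mem_insert_self _ _))]
    simp

theorem pderiv_sumProd {K : Type*} [Field K] (d m : ℕ) (i : Fin m) (k : Fin d) :
    pderiv (i, k) (∑ i : Fin m, ∏ j : Fin d, (X (i, j) : MvPolynomial (Fin m × Fin d) K)) =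
      ∏ l ∈ Finset.univ.erase k, X (i, l) := by
  classical
  rw [map_sum, Finset.sum_eq_single i]
  · rw [← Finset.mul_prod_erase _ _ (Finset.mem_univ k), pderiv_mul, pderiv_X_self,
      pderiv_prod_zero (i, k) (fun l => (i, l))]
    · simp
    · intro l hl h
      simp only [Prod.mk.injEq, true_and] at h
      simp [h] at hl
  · intro b _ hb
    apply pderiv_prod_zero (i, k) (fun l => (b, l))
    intro l _ h
    simp only [Prod.mk.injEq] at h
    exact hb h.1
  · simp

/-- the coefficients of `∏ (T - x_{il})`, up to sign the elementary symmetric polynomials -/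
noncomputable def blockPoly (K : Type*) [Field K] (d m : ℕ) (i : Fin m) :
    Polynomial (MvPolynomial (Fin m × Fin d) K) :=
  ∏ l : Fin d, (Polynomial.X - Polynomial.C (X (i, l)))

theorem core {K : Type*} [Field K] (e m r : ℕ)
    (Q R : Fin r → MvPolynomial (Fin m × Fin (e + 2)) K)
    (hQ : ∀ i, (Q i).totalDegree < e + 2) (hR : ∀ i, (R i).totalDegree < e + 2)
    (h : ∑ i : Fin m, ∏ j : Fin (e + 2), (X (i, j) : MvPolynomial (Fin m × Fin (e + 2)) K)
      = ∑ i, Q i * R i) : m ≤ r := by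
  classical
  let F : Fin r → MvPolynomial (Fin m × Fin (e + 2)) K := fun i => Q i - C (constantCoeff (Q i))
  let G : Fin r → MvPolynomial (Fin m × Fin (e + 2)) K := fun i => R i - C (constantCoeff (R i))
  let g : (Fin r ⊕ Fin r) ⊕ (Fin m × Fin e) → MvPolynomial (Fin m × Fin (e + 2)) K :=
    Sum.elim (Sum.elim F G) (fun x => (blockPoly K (e + 2) m x.1).coeff (x.2 + 2))
  set J := Ideal.span (Set.range g) with hJ
  have hg : ∀ x, g x ∈ J := fun x => Ideal.subset_span ⟨x, rfl⟩
  have hne : J ≠ ⊤ := by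
    have : J ≤ RingHom.ker (constantCoeff : MvPolynomial (Fin m × Fin (e + 2)) K →+* K) := by
      rw [hJ, Ideal.span_le]
      rintro _ ⟨x, rfl⟩
      rw [SetLike.mem_coe, RingHom.mem_ker]
      rcases x with (x | x) | x
      · simp [g, F]
      · simp [g, G]
      · simp only [g, Sum.elim_inr]
        rw [← Polynomial.coeff_map, blockPoly, Polynomial.map_prod]
        have := x.2.2
        simp only [Polynomial.map_sub, Polynomial.map_X, Polynomial.map_C, constantCoeff_X, map_zero,
          sub_zero, Finset.prod_const, Finset.card_univ, Fintype.card_fin, Polynomial.coeff_X_pow]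
        rw [if_neg (by omega)]
    intro ht
    rw [ht] at this
    exact RingHom.ker_ne_top _ (top_le_iff.1 this)
  have hpd : ∀ i k, (∏ l ∈ Finset.univ.erase k, X (i, l)) ∈ lowDeg J e := by
    intro i k
    rw [← pderiv_sumProd, h, map_sum]
    refine Submodule.sum_mem _ fun a _ => ?_
    have : pderiv (i, k) (Q a * R a) = (pderiv (i, k) (Q a) * G a + F a * pderiv (i, k) (R a))
        + (constantCoeff (R a) • pderiv (i, k) (Q a) +
          constantCoeff (Q a) • pderiv (i, k) (R a)) := by
      rw [pderiv_mul, smul_eq_C_mul, smul_eq_C_mul]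
      simp only [F, G]
      ring
    rw [this]
    refine Submodule.add_mem _ (lowDeg_of_mem (J.add_mem ?_ ?_)) (Submodule.add_mem _
      (Submodule.smul_mem _ _ (lowDeg_of_deg ?_)) (Submodule.smul_mem _ _ (lowDeg_of_deg ?_)))
    · exact J.mul_mem_left _ (hg (.inl (.inr a)))
    · exact J.mul_mem_right _ (hg (.inl (.inl a)))
    · have := totalDegree_pderiv_le' (Q a) (i, k)
      have := hQ a
      omega
    · have := totalDegree_pderiv_le' (R a) (i, k)
      have := hR a
      omega
  have hc1 : ∀ i, (blockPoly K (e + 2) m i).coeff 1 ∈ lowDeg J e := by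
    intro i
    have h1 : (blockPoly K (e + 2) m i).coeff 1 =
        (Polynomial.derivative (blockPoly K (e + 2) m i)).eval 0 := by
      rw [← Polynomial.coeff_zero_eq_eval_zero, Polynomial.coeff_derivative]
      simp
    rw [h1, blockPoly, Polynomial.derivative_prod_finset, Polynomial.eval_finsetSum]
    refine Submodule.sum_mem _ fun k _ => ?_
    have h2 : Polynomial.eval 0 ((∏ b ∈ Finset.univ.erase k, (Polynomial.X - Polynomial.C
        (X (i, b) : MvPolynomial (Fin m × Fin (e + 2)) K))) *
        Polynomial.derivative (Polynomial.X - Polynomial.C (X (i, k)))) =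
        ((-1 : K) ^ (e + 1)) • ∏ l ∈ Finset.univ.erase k, X (i, l) := by
      simp [Polynomial.eval_prod, Finset.prod_neg, smul_eq_C_mul]
    rw [h2]
    exact Submodule.smul_mem _ _ (hpd i k)
  have hc0 : ∀ i, (blockPoly K (e + 2) m i).coeff 0 ∈ lowDeg J (e + 1) := by
    intro i
    have h2 : (blockPoly K (e + 2) m i).coeff 0 =
        ((-1 : K) ^ (e + 2)) • ((∏ l ∈ Finset.univ.erase 0, X (i, l)) * X (i, 0)) := by
      rw [Finset.prod_erase_mul _ _ (Finset.mem_univ _)]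
      simp [blockPoly, Polynomial.coeff_zero_eq_eval_zero, Polynomial.eval_prod, Finset.prod_neg,
        smul_eq_C_mul]
    rw [h2]
    exact Submodule.smul_mem _ _ (lowDeg_mul (hpd i 0) (totalDegree_X _).le)
  have hX : ∀ j : Fin m × Fin (e + 2),
      (X j : MvPolynomial (Fin m × Fin (e + 2)) K) ^ (e + 2) ∈ lowDeg J (e + 2 - 1) := by
    rintro ⟨i, k⟩
    have hdeg : (blockPoly K (e + 2) m i).natDegree = e + 2 := by
      simp [blockPoly]
    have hmon : (blockPoly K (e + 2) m i).Monic :=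
      Polynomial.monic_prod_of_monic _ _ fun l _ => Polynomial.monic_X_sub_C _
    have h0 : (blockPoly K (e + 2) m i).eval (X (i, k)) = 0 := by
      rw [blockPoly, Polynomial.eval_prod]
      exact Finset.prod_eq_zero (Finset.mem_univ k) (by simp)
    have hlead : (blockPoly K (e + 2) m i).coeff (e + 2) = 1 := by
      have h1 := hmon.coeff_natDegree
      rwa [hdeg] at h1
    rw [Polynomial.eval_eq_sum_range, hdeg, Finset.sum_range_succ, hlead, Finset.sum_range_succ',
      Finset.sum_range_succ', one_mul, pow_zero, mul_one, zero_add, pow_one] at h0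
    rw [eq_neg_of_add_eq_zero_right h0]
    refine Submodule.neg_mem _ (Submodule.add_mem _ (Submodule.add_mem _
      (Submodule.sum_mem _ fun s hs => ?_) ?_) (hc0 i))
    · have hs' := Finset.mem_range.1 hs
      exact lowDeg_of_mem (J.mul_mem_right _ (hg (.inr (i, ⟨s, hs'⟩))))
    · exact lowDeg_mul (hc1 i) (totalDegree_X _).le
  have hcard := card_le_of_finite (by omega) g hne hX
  simp only [Fintype.card_prod, Fintype.card_sum, Fintype.card_fin] at hcard
  nlinarith

theorem totalDegree_sumProd {K : Type*} [Field K] (d m : ℕ) (hd : 1 ≤ d) (hm : 1 ≤ m) :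
    (∑ i : Fin m, ∏ j : Fin d, (X (i, j) : MvPolynomial (Fin m × Fin d) K)).totalDegree = d := by
  classical
  apply IsHomogeneous.totalDegree
  · apply IsHomogeneous.sum
    intro i _
    have := IsHomogeneous.prod (Finset.univ : Finset (Fin d))
      (fun j => (X (i, j) : MvPolynomial (Fin m × Fin d) K)) (fun _ => 1)
      (fun j _ => isHomogeneous_X _ _)
    simpa using this
  · intro h0
    have := congrArg (eval (fun x : Fin m × Fin d => if x.1 = ⟨0, hm⟩ then (1 : K) else 0)) h0
    simp only [map_sum, map_prod, eval_X, map_zero] at this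
    rw [Finset.sum_eq_single (⟨0, hm⟩ : Fin m)] at this
    · simp at this
    · intro b _ hb
      exact Finset.prod_eq_zero (Finset.mem_univ (⟨0, hd⟩ : Fin d)) (if_neg hb)
    · intro hb
      exact absurd (Finset.mem_univ _) hb

theorem aeval_multiDiff {K : Type*} [Field K] (d m : ℕ) :
    aeval (fun x : Fin d × (Fin m × Fin d) =>
      if x.1 = x.2.2 then (X x.2 : MvPolynomial (Fin m × Fin d) K) else 0)
      (multiDiff d (∑ i : Fin m, ∏ j : Fin d, (X (i, j) : MvPolynomial (Fin m × Fin d) K))) =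
    ∑ i : Fin m, ∏ j : Fin d, (X (i, j) : MvPolynomial (Fin m × Fin d) K) := by
  classical
  unfold multiDiff
  rw [map_sum, Finset.sum_eq_single Finset.univ]
  · simp
  · intro S _ hS
    obtain ⟨j, hj⟩ : ∃ j, j ∉ S := by
      by_contra hcon
      push Not at hcon
      exact hS (Finset.eq_univ_iff_forall.2 hcon)
    rw [map_smul]
    simp only [map_sum, map_prod, aeval_X]
    rw [Finset.sum_eq_zero, smul_zero]
    intro i _
    apply Finset.prod_eq_zero (Finset.mem_univ j)
    apply Finset.sum_eq_zero
    intro k hk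
    rw [if_neg]
    rintro rfl
    exact hj hk
  · simp

/-- Fix `d ≥ 1` and `m ≥ 1`. Let `K` be a field, `W = K^d`,
`μ : W → K` the product of the coordinates, `V_m = W^m`, and
`Q_m(w_1,...,w_m) = ∑_{i=1}^m μ(w_i)`. Then the nc-rank of `Q_m` is at least `m`. -/
theorem stmt10 (K : Type*) [Field K] (d m : ℕ) (hd : 1 ≤ d) (hm : 1 ≤ m) :
    ncRankGE (∑ i : Fin m, ∏ j : Fin d, (X (i, j) : MvPolynomial (Fin m × Fin d) K)) m := by
  unfold ncRankGE
  rw [totalDegree_sumProd d m hd hm]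
  intro r Q R hQ hR h
  have hφ : ∀ x : Fin d × (Fin m × Fin d),
      (if x.1 = x.2.2 then (X x.2 : MvPolynomial (Fin m × Fin d) K) else 0).totalDegree ≤ 1 := by
    intro x
    split_ifs
    · exact (totalDegree_X _).le
    · simp
  have h' := congrArg (aeval (fun x : Fin d × (Fin m × Fin d) =>
      if x.1 = x.2.2 then (X x.2 : MvPolynomial (Fin m × Fin d) K) else 0)) h
  rw [aeval_multiDiff, map_sum] at h'
  simp only [map_mul] at h'
  have hQ' := fun i => (totalDegree_aeval_le' _ hφ (Q i)).trans_lt (hQ i)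
  have hR' := fun i => (totalDegree_aeval_le' _ hφ (R i)).trans_lt (hR i)
  obtain rfl | hd2 : d = 1 ∨ 2 ≤ d := by omega
  · exfalso
    have h1 := totalDegree_sumProd (K := K) 1 m le_rfl hm
    rw [h'] at h1
    have h2 := (totalDegree_finsetSum (Finset.univ : Finset (Fin r)) (fun i =>
      (aeval (fun x : Fin 1 × (Fin m × Fin 1) =>
        if x.1 = x.2.2 then (X x.2 : MvPolynomial (Fin m × Fin 1) K) else 0) (Q i)) *
      (aeval (fun x : Fin 1 × (Fin m × Fin 1) =>
        if x.1 = x.2.2 then (X x.2 : MvPolynomial (Fin m × Fin 1) K) else 0) (R i)))).trans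
      (Finset.sup_le (a := 0) fun i _ => (totalDegree_mul _ _).trans
        (by have := hQ' i; have := hR' i; omega))
    omega
  · obtain ⟨e, rfl⟩ : ∃ e, d = e + 2 := ⟨d - 2, by omega⟩
    exact core e m r _ _ hQ' hR' h'
end

section
/- Let P̄ = (P_1,...,P_c) be polynomials P_i ∈ F_q[x_1,...,x_n] of degrees d_i, 1 ≤ i ≤ c, such that the affine variety Y ⊂ A^n defined by P_1 = ... = P_c = 0 has dimension n - c (equivalently, the quotient of F̄_q[x_1,...,x_n] by the ideal generated by P_1,...,P_c has Krull dimension n - c, where F̄_q is the algebraic closure of F_q). Then the number of points x ∈ F_q^n with P_1(x) = ... = P_c(x) = 0 is at most q^{n-c}·D, where D = Π_{i=1}^c d_i. -/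
open MvPolynomial

theorem aux_height_maximal {k : Type*} [Field k] (n : ℕ) (M : Ideal (MvPolynomial (Fin n) k))
    [hM : M.IsMaximal] : M.height = n := by
  induction n with
  | zero =>
    have : M = ⊥ := by
      have e := MvPolynomial.isEmptyRingEquiv k (Fin 0)
      have hf : IsField (MvPolynomial (Fin 0) k) := e.toMulEquiv.isField (Field.toIsField k)
      let _ := hf.toField
      exact (Ideal.eq_bot_or_top M).resolve_right hM.ne_top
    subst this
    simp
  | succ n ih =>
    let e := (MvPolynomial.finSuccEquiv k n).toRingEquiv
    let P : Ideal (Polynomial (MvPolynomial (Fin n) k)) := M.comap e.symm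
    have hP : P.IsMaximal := Ideal.comap_isMaximal_of_equiv e.symm
    have h1 : P.height = M.height := RingEquiv.height_comap e.symm M
    have hp : (P.under (MvPolynomial (Fin n) k)).IsMaximal :=
      Polynomial.isMaximal_comap_C_of_isJacobsonRing P
    have hl : P.LiesOver (P.under (MvPolynomial (Fin n) k)) := ⟨rfl⟩
    have h2 := Polynomial.height_eq_height_add_one (P.under (MvPolynomial (Fin n) k)) P
    rw [← h1, h2, ih]
    simp

theorem aux_dim_le_of_integral {R B : Type*} [CommRing R] [CommRing B] [Algebra R B]
    [Algebra.IsIntegral R B] : ringKrullDim B ≤ ringKrullDim R := by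
  refine Order.krullDim_le_of_strictMono (PrimeSpectrum.comap (algebraMap R B)) ?_
  intro I J hIJ
  exact Ideal.IsIntegral.comap_lt_comap (R := R) (I := I.asIdeal) (J := J.asIdeal) hIJ

theorem aux_dim_ge_of_integral {R B : Type*} [CommRing R] [CommRing B] [Algebra R B]
    [Algebra.IsIntegral R B] (hinj : Function.Injective (algebraMap R B)) :
    ringKrullDim R ≤ ringKrullDim B := by
  refine iSup_le fun l => ?_
  obtain ⟨P, hP, hPl⟩ := Ideal.exists_ideal_over_prime_of_isIntegral (S := B) l.head.asIdeal ⊥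
    (by
      intro x hx
      have : x = 0 := hinj (by simpa using hx)
      simp [this])
  obtain ⟨hP1, hP2⟩ := hPl
  have : P.LiesOver (RelSeries.head l).asIdeal := ⟨hP2.symm⟩
  obtain ⟨L, hL, -, -⟩ := Ideal.exists_ltSeries_of_hasGoingUp l P
  rw [← hL]
  exact Order.LTSeries.length_le_krullDim L

theorem aux_dim_poly {k : Type*} [Field k] (s : ℕ) (q : Ideal (MvPolynomial (Fin s) k)) [q.IsPrime]
    (hq : q.height ≤ 1) : (s : WithBot ℕ∞) ≤ ringKrullDim (MvPolynomial (Fin s) k ⧸ q) + 1 := by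
  by_cases hb : q = ⊥
  · subst hb
    rw [ringKrullDim_eq_of_ringEquiv (RingEquiv.quotientBot _),
      MvPolynomial.ringKrullDim_of_isNoetherianRing]
    simp only [ringKrullDim_eq_zero_of_field, Nat.card_eq_fintype_card, Fintype.card_fin, zero_add]
    exact_mod_cast Nat.le_succ s
  · obtain ⟨x, hx, hxp⟩ := Ideal.IsPrime.exists_mem_prime_of_ne_bot ‹_› hb
    have h1 : q.height = 1 := by
      refine le_antisymm hq ?_
      rw [Order.one_le_iff_ne_zero]
      intro h
      exact hb (Ideal.height_eq_zero_iff_eq_bot.mp h)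
    have := Ideal.eq_span_singleton_of_height_eq_one h1 hx hxp
    obtain ⟨M, hM, hqM⟩ := Ideal.exists_le_maximal q (Ideal.IsPrime.ne_top ‹_›)
    have h3 := Ideal.height_le_ringKrullDim_quotient_add_one (hqM hx)
    rw [← this, aux_height_maximal s M] at h3
    exact_mod_cast h3

theorem aux_dim_domain (k : Type*) {B : Type*} [Field k] [CommRing B] [IsDomain B] [Algebra k B]
    [Algebra.FiniteType k B] (P : Ideal B) [P.IsPrime] (hP : P.height ≤ 1) :
    ringKrullDim B ≤ ringKrullDim (B ⧸ P) + 1 := by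
  obtain ⟨s, g, hg, hint⟩ := exists_integral_inj_algHom_of_fg k B
  algebraize [g.toRingHom]
  have hinj : Function.Injective (algebraMap (MvPolynomial (Fin s) k) B) := hg
  have : FaithfulSMul (MvPolynomial (Fin s) k) B := (faithfulSMul_iff_algebraMap_injective _ _).mpr hinj
  have hI : Algebra.IsIntegral (MvPolynomial (Fin s) k) B := ⟨hint⟩
  have : IsNoetherianRing B := Algebra.FiniteType.isNoetherianRing k B
  have h1 : ringKrullDim B ≤ s := by
    refine (aux_dim_le_of_integral (R := MvPolynomial (Fin s) k)).trans ?_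
    rw [MvPolynomial.ringKrullDim_of_isNoetherianRing]
    simp
  let q := P.under (MvPolynomial (Fin s) k)
  have hq : q.height ≤ 1 := by
    refine le_trans ?_ hP
    rw [Ideal.height_eq_height_add_of_liesOver_of_hasGoingDown q P]
    exact le_self_add
  have h2 := aux_dim_poly s q hq
  have h3 : ringKrullDim (MvPolynomial (Fin s) k ⧸ q) ≤ ringKrullDim (B ⧸ P) :=
    aux_dim_ge_of_integral (Ideal.algebraMap_quotient_injective)
  exact h1.trans (h2.trans (by gcongr))

theorem aux_dim_step {k : Type*} [Field k] {n : ℕ} (p p' : Ideal (MvPolynomial (Fin n) k))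
    [p.IsPrime] (f : MvPolynomial (Fin n) k)
    (hp' : p' ∈ (p ⊔ Ideal.span {f}).minimalPrimes) (r : ℕ)
    (hr : ((r + 1 : ℕ) : WithBot ℕ∞) ≤ ringKrullDim (MvPolynomial (Fin n) k ⧸ p)) :
    (r : WithBot ℕ∞) ≤ ringKrullDim (MvPolynomial (Fin n) k ⧸ p') := by
  have hpr : p'.IsPrime := hp'.1.1
  have hle : p ≤ p' := le_sup_left.trans hp'.1.2
  have h := Ideal.map_height_le_one_of_mem_minimalPrimes hp'
  have : (p'.map (Ideal.Quotient.mk p)).IsPrime :=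
    Ideal.map_isPrime_of_surjective Ideal.Quotient.mk_surjective (by simpa using hle)
  have h2 := aux_dim_domain k _ h
  rw [ringKrullDim_eq_of_ringEquiv (DoubleQuot.quotQuotEquivQuotOfLE hle)] at h2
  have h3 := hr.trans h2
  push_cast at h3
  revert h3
  generalize ringKrullDim (MvPolynomial (Fin n) k ⧸ p') = x
  intro h3
  cases x with
  | bot => simp at h3
  | coe x =>
    have h4 : ((r : ℕ∞) + 1) ≤ x + 1 := by exact_mod_cast h3
    have h5 : (r : ℕ∞) ≤ x := by
      cases x with
      | top => simp
      | coe x =>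
        have h6 : r + 1 ≤ x + 1 := by exact_mod_cast h4
        exact_mod_cast (by omega : r ≤ x)
    exact_mod_cast h5

/-- Affine Hilbert function of an ideal `J`. -/
noncomputable def auxH {k : Type*} [Field k] {n : ℕ} (J : Ideal (MvPolynomial (Fin n) k)) (t : ℕ) : ℕ :=
  Module.finrank k ((restrictTotalDegree (Fin n) k t).map (Ideal.Quotient.mkₐ k J).toLinearMap)

theorem auxH_mono {k : Type*} [Field k] {n : ℕ} (J : Ideal (MvPolynomial (Fin n) k)) :
    Monotone (auxH J) := by
  intro a b hab
  refine Submodule.finrank_mono (Submodule.map_mono ?_)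
  intro p hp
  rw [mem_restrictTotalDegree] at hp ⊢
  exact hp.trans hab

theorem auxH_le {k : Type*} [Field k] {n : ℕ} (J : Ideal (MvPolynomial (Fin n) k)) (t : ℕ) :
    auxH J t ≤ Module.finrank k (restrictTotalDegree (Fin n) k t) :=
  Submodule.finrank_map_le _ _

theorem auxH_map {k : Type*} [Field k] {n : ℕ} {J J' : Ideal (MvPolynomial (Fin n) k)}
    (hJ : J ≤ J') (t : ℕ) :
    (restrictTotalDegree (Fin n) k t).map (Ideal.Quotient.mkₐ k J').toLinearMap =
    ((restrictTotalDegree (Fin n) k t).map (Ideal.Quotient.mkₐ k J).toLinearMap).map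
      (Ideal.Quotient.factorₐ k hJ).toLinearMap := by
  rw [← Submodule.map_comp]
  rfl

theorem auxH_anti {k : Type*} [Field k] {n : ℕ} {J J' : Ideal (MvPolynomial (Fin n) k)}
    (hJ : J ≤ J') (t : ℕ) : auxH J' t ≤ auxH J t := by
  unfold auxH
  rw [auxH_map hJ]
  exact Submodule.finrank_map_le _ _

theorem auxH_step {k : Type*} [Field k] {n : ℕ} {J J' : Ideal (MvPolynomial (Fin n) k)}
    (hJ : J ≤ J') (f : MvPolynomial (Fin n) k) (hf : f ∈ J') (hreg : ∀ g, f * g ∈ J → g ∈ J)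
    (d t : ℕ) (hd : f.totalDegree ≤ d) (hdt : d ≤ t) :
    auxH J' t + auxH J (t - d) ≤ auxH J t := by
  unfold auxH
  rw [auxH_map hJ]
  set V := (restrictTotalDegree (Fin n) k t).map (Ideal.Quotient.mkₐ k J).toLinearMap with hV
  set W := (restrictTotalDegree (Fin n) k (t - d)).map (Ideal.Quotient.mkₐ k J).toLinearMap with hW
  set φ := (Ideal.Quotient.factorₐ k hJ).toLinearMap with hφ
  rw [← LinearMap.finrank_range_add_finrank_ker (φ.domRestrict V), LinearMap.range_domRestrict]
  refine Nat.add_le_add_left ?_ _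
  have hmem : ∀ w ∈ W, Ideal.Quotient.mk J f * w ∈ V := by
    rintro _ ⟨g, hg, rfl⟩
    refine ⟨f * g, ?_, by simp⟩
    have hg' : g.totalDegree ≤ t - d := (mem_restrictTotalDegree _ _ _).mp hg
    refine (mem_restrictTotalDegree _ _ _).mpr ?_
    have := totalDegree_mul f g
    omega
  let μ : W →ₗ[k] LinearMap.ker (φ.domRestrict V) :=
    { toFun := fun w => ⟨⟨Ideal.Quotient.mk J f * w, hmem w w.2⟩, by
        simp only [LinearMap.mem_ker, LinearMap.domRestrict_apply, hφ, AlgHom.toLinearMap_apply,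
          map_mul]
        have : (Ideal.Quotient.factorₐ k hJ) (Ideal.Quotient.mk J f) = 0 := by
          simpa [Ideal.Quotient.eq_zero_iff_mem] using hf
        rw [this, zero_mul]⟩
      map_add' := fun a b => by
        ext; simp [mul_add]
      map_smul' := fun a b => by
        ext; simp }
  refine LinearMap.finrank_le_finrank_of_injective (f := μ) ?_
  rintro ⟨w1, hw1⟩ ⟨w2, hw2⟩ h0
  obtain ⟨g1, _, rfl⟩ := hw1
  obtain ⟨g2, _, rfl⟩ := hw2
  have h1 : Ideal.Quotient.mk J f * Ideal.Quotient.mk J g1 =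
      Ideal.Quotient.mk J f * Ideal.Quotient.mk J g2 :=
    congrArg (fun x => ((x : V) : MvPolynomial (Fin n) k ⧸ J)) (congrArg Subtype.val h0)
  rw [← map_mul, ← map_mul, Ideal.Quotient.eq, ← mul_sub] at h1
  exact Subtype.ext (Ideal.Quotient.eq.mpr (hreg _ h1))

theorem auxH_sum {k : Type*} [Field k] {n : ℕ} {J J' : Ideal (MvPolynomial (Fin n) k)}
    (hJ : J ≤ J') (f : MvPolynomial (Fin n) k) (hf : f ∈ J') (hreg : ∀ g, f * g ∈ J → g ∈ J)
    (d : ℕ) (hd : f.totalDegree ≤ d) (hd1 : 1 ≤ d) (t : ℕ) :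
    ∑ u ∈ Finset.range (t + 1), auxH J' u ≤ d * auxH J t := by
  induction t using Nat.strong_induction_on with
  | _ t ih =>
    have hmono : ∀ u ≤ t, auxH J' u ≤ auxH J' t := fun u hu => auxH_mono J' hu
    by_cases hdt : d ≤ t
    · have h1 := ih (t - d) (by omega)
      have h2 := auxH_step hJ f hf hreg d t hd hdt
      have h3 : ∑ u ∈ Finset.range (t + 1), auxH J' u =
          ∑ u ∈ Finset.range (t - d + 1), auxH J' u +
          ∑ u ∈ Finset.range d, auxH J' (t - d + 1 + u) := by
        rw [← Finset.sum_range_add]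
        congr 2
        omega
      have h4 : ∑ u ∈ Finset.range d, auxH J' (t - d + 1 + u) ≤ d * auxH J' t := by
        refine (Finset.sum_le_card_nsmul _ _ (auxH J' t) ?_).trans (by simp)
        intro u hu
        exact hmono _ (by have := Finset.mem_range.mp hu; omega)
      rw [h3]
      nlinarith
    · have h4 : ∑ u ∈ Finset.range (t + 1), auxH J' u ≤ (t + 1) * auxH J' t := by
        refine (Finset.sum_le_card_nsmul _ _ (auxH J' t) ?_).trans (by simp)
        intro u hu
        exact hmono _ (by have := Finset.mem_range.mp hu; omega)
      refine h4.trans ?_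
      exact Nat.mul_le_mul (by omega) (auxH_anti hJ t)

/-- Minimal primes over `I` through one of the given points. -/
def auxX {k : Type*} [Field k] {n : ℕ} {ι : Type*} (pt : ι → Fin n → k)
    (I : Ideal (MvPolynomial (Fin n) k)) : Set (Ideal (MvPolynomial (Fin n) k)) :=
  {p | p ∈ I.minimalPrimes ∧ ∃ s, p ≤ RingHom.ker (eval (pt s))}

theorem auxX_sum {k : Type*} [Field k] {n : ℕ} {ι : Type*} (pt : ι → Fin n → k)
    (I : Ideal (MvPolynomial (Fin n) k)) (f : MvPolynomial (Fin n) k)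
    (hf : ∀ p ∈ auxX pt I, f ∉ p)
    (d : ℕ) (hd : f.totalDegree ≤ d) (hd1 : 1 ≤ d) (t : ℕ) :
    ∑ u ∈ Finset.range (t + 1), auxH (sInf (auxX pt (I ⊔ Ideal.span {f}))) u ≤
      d * auxH (sInf (auxX pt I)) t := by
  refine auxH_sum ?_ f ?_ ?_ d hd hd1 t
  · refine le_sInf ?_
    rintro p ⟨hp, s, hs⟩
    have hpp : p.IsPrime := hp.1.1
    obtain ⟨p', hp', hle⟩ := Ideal.exists_minimalPrimes_le (I := I) (J := p)
      (le_sup_left.trans hp.1.2)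
    exact (sInf_le (show p' ∈ auxX pt I from ⟨hp', s, hle.trans hs⟩)).trans hle
  · rw [Ideal.mem_sInf]
    rintro p ⟨hp, -⟩
    exact hp.1.2 (Ideal.mem_sup_right (Ideal.mem_span_singleton_self f))
  · intro g hg
    rw [Ideal.mem_sInf] at hg ⊢
    intro p hp
    have hpp : p.IsPrime := hp.1.1.1
    exact (hpp.mem_or_mem (hg hp)).resolve_left (hf p hp)

theorem auxX_dim {k : Type*} [Field k] {n : ℕ} {ι : Type*} (pt : ι → Fin n → k)
    (I : Ideal (MvPolynomial (Fin n) k)) (f : MvPolynomial (Fin n) k) (r : ℕ)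
    (hI : ∀ p ∈ auxX pt I, ((r + 1 : ℕ) : WithBot ℕ∞) ≤ ringKrullDim (MvPolynomial (Fin n) k ⧸ p)) :
    ∀ p ∈ auxX pt (I ⊔ Ideal.span {f}),
      ((r : ℕ) : WithBot ℕ∞) ≤ ringKrullDim (MvPolynomial (Fin n) k ⧸ p) := by
  rintro p ⟨hp, s, hs⟩
  have hpp : p.IsPrime := hp.1.1
  obtain ⟨p', hp', hle⟩ := Ideal.exists_minimalPrimes_le (I := I) (J := p)
    (le_sup_left.trans hp.1.2)
  have hpp' : p'.IsPrime := hp'.1.1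
  refine aux_dim_step p' p f ?_ r (hI p' ⟨hp', s, hle.trans hs⟩)
  refine ⟨⟨hpp, sup_le hle (le_sup_right.trans hp.1.2)⟩, ?_⟩
  rintro q ⟨hq, hq2⟩ hqp
  exact hp.2 ⟨hq, (sup_le_sup_right hp'.1.2 _).trans hq2⟩ hqp

theorem aux_chain {k : Type*} [Field k] {n : ℕ} (x : Fin n → k)
    (L : List (MvPolynomial (Fin n) k)) (hL : ∀ f ∈ L, eval x f = 0) (r : ℕ)
    (p : Ideal (MvPolynomial (Fin n) k)) (hp : p.IsPrime) (hpx : p ≤ RingHom.ker (eval x))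
    (hdim : ((L.length + r : ℕ) : WithBot ℕ∞) ≤ ringKrullDim (MvPolynomial (Fin n) k ⧸ p)) :
    ∃ p' : Ideal (MvPolynomial (Fin n) k), p'.IsPrime ∧ p ≤ p' ∧ (∀ f ∈ L, f ∈ p') ∧
      (r : WithBot ℕ∞) ≤ ringKrullDim (MvPolynomial (Fin n) k ⧸ p') := by
  induction L generalizing p with
  | nil => exact ⟨p, hp, le_rfl, by simp, by simpa using hdim⟩
  | cons f L ih =>
    have hker : (RingHom.ker (eval x)).IsPrime := RingHom.ker_isPrime _
    obtain ⟨p1, hp1, hle⟩ := Ideal.exists_minimalPrimes_le (I := p ⊔ Ideal.span {f})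
      (J := RingHom.ker (eval x)) (sup_le hpx (by
        rw [Ideal.span_singleton_le_iff_mem]
        exact hL f (by simp)))
    have h1 := aux_dim_step p p1 f hp1 (L.length + r) (by
      rw [List.length_cons] at hdim
      convert hdim using 2
      omega)
    obtain ⟨p', h2, h3, h4, h5⟩ := ih (fun g hg => hL g (by simp [hg])) p1 hp1.1.1 hle h1
    refine ⟨p', h2, (le_sup_left.trans hp1.1.2).trans h3, ?_, h5⟩
    intro g hg
    rcases List.mem_cons.mp hg with rfl | hg
    · exact h3 (hp1.1.2 (Ideal.mem_sup_right (Ideal.mem_span_singleton_self g)))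
    · exact h4 g hg

theorem aux_finrank {k : Type*} [Field k] {n : ℕ} (t : ℕ) :
    Module.finrank k (restrictTotalDegree (Fin n) k t) ≤ (t + n).choose n := by
  have h1 : Module.finrank k (restrictTotalDegree (Fin n) k t) =
      Nat.card {s : Fin n →₀ ℕ | (s.sum fun _ e => e) ≤ t} :=
    Module.finrank_eq_nat_card_basis (basisRestrictSupport k _)
  rw [h1]
  let φ : {s : Fin n →₀ ℕ | (s.sum fun _ e => e) ≤ t} →
      ((Finset.univ : Finset (Fin (n + 1))).finsuppAntidiag t) := fun s =>
    ⟨Finsupp.cons (t - (s.1.sum fun _ e => e)) s.1, by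
      rw [Finset.mem_finsuppAntidiag]
      refine ⟨?_, Finset.subset_univ _⟩
      rw [Fin.sum_univ_succ]
      have hs : (s.1.sum fun _ e => e) ≤ t := s.2
      have : (s.1.sum fun _ e => e) = ∑ i, s.1 i := Finsupp.sum_fintype _ _ (by simp)
      simp only [Finsupp.cons_zero, Finsupp.cons_succ]
      omega⟩
  have hφ : Function.Injective φ := by
    intro a b hab
    have h2 := congrArg Subtype.val hab
    have h3 := congrArg Finsupp.tail h2
    simp only [φ, Finsupp.tail_cons] at h3
    exact Subtype.ext h3
  refine (Nat.card_le_card_of_injective φ hφ).trans ?_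
  rw [Nat.card_eq_fintype_card, Fintype.card_coe, Finset.card_finsuppAntidiag_nat_eq_choose]
  simp only [Finset.card_univ, Fintype.card_fin]
  have e : n + 1 + t - 1 = t + n := by omega
  rw [e, Nat.choose_symm_add]

theorem aux_limit (N D n t0 : ℕ)
    (h : ∀ t, N * (t + n).choose n ≤ D * (t + t0 + n).choose n) : N ≤ D := by
  have hlim : Filter.Tendsto (fun t : ℕ => (D : ℝ) * (1 + ((t0 + n : ℕ) : ℝ) / t) ^ n)
      Filter.atTop (nhds ((D : ℝ) * (1 + 0) ^ n)) := by
    refine Filter.Tendsto.const_mul _ (Filter.Tendsto.pow ?_ n)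
    exact tendsto_const_nhds.add (tendsto_const_div_atTop_nhds_zero_nat _)
  have h2 : (N : ℝ) ≤ (D : ℝ) * (1 + 0) ^ n := by
    refine ge_of_tendsto hlim ?_
    filter_upwards [Filter.eventually_gt_atTop 0] with t ht
    have h3 : (N : ℝ) * ((t + n).choose n : ℝ) ≤ D * ((t + t0 + n).choose n : ℝ) := by
      exact_mod_cast h t
    have h4 : ((t : ℝ) ^ n) / (n.factorial : ℝ) ≤ ((t + n).choose n : ℝ) := by
      have h5 := Nat.pow_le_choose (α := ℝ) n (t + n)
      refine le_trans ?_ h5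
      have : t ≤ t + n + 1 - n := by omega
      gcongr
    have h6 := Nat.choose_le_pow_div (α := ℝ) n (t + t0 + n)
    have hn : (0 : ℝ) < (n.factorial : ℝ) := by exact_mod_cast Nat.factorial_pos n
    have h7 : (N : ℝ) * ((t : ℝ) ^ n / (n.factorial : ℝ)) ≤
        D * (((t + t0 + n : ℕ) : ℝ) ^ n / (n.factorial : ℝ)) :=
      (mul_le_mul_of_nonneg_left h4 (by positivity)).trans
        (h3.trans (mul_le_mul_of_nonneg_left h6 (by positivity)))
    have ht' : (0 : ℝ) < t := by exact_mod_cast ht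
    have h8 : (N : ℝ) * (t : ℝ) ^ n ≤ D * ((t + t0 + n : ℕ) : ℝ) ^ n := by
      rw [← mul_div_assoc, ← mul_div_assoc] at h7
      exact (div_le_div_iff_of_pos_right hn).mp h7
    have h9 : (1 + ((t0 + n : ℕ) : ℝ) / t) = ((t + t0 + n : ℕ) : ℝ) / t := by
      push_cast
      field_simp
      ring
    rw [h9, div_pow, ← mul_div_assoc, le_div_iff₀ (by positivity)]
    exact h8
  simp at h2
  exact h2

theorem aux_comb (N D d r t0 : ℕ) (F G : ℕ → ℕ)
    (h1 : ∀ u, N * (u + r).choose r ≤ D * F (u + t0))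
    (h2 : ∀ t, ∑ u ∈ Finset.range (t + 1), F u ≤ d * G t) (t : ℕ) :
    N * (t + (r + 1)).choose (r + 1) ≤ (d * D) * G (t + t0) := by
  have e : (t + (r + 1)).choose (r + 1) = ∑ u ∈ Finset.range (t + 1), (u + r).choose r :=
    (Nat.sum_range_add_choose t r).symm
  calc N * (t + (r + 1)).choose (r + 1)
      = ∑ u ∈ Finset.range (t + 1), N * (u + r).choose r := by rw [e, Finset.mul_sum]
    _ ≤ ∑ u ∈ Finset.range (t + 1), D * F (t0 + u) :=
        Finset.sum_le_sum fun u _ => by rw [add_comm t0 u]; exact h1 u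
    _ = D * ∑ u ∈ Finset.range (t + 1), F (t0 + u) := by rw [Finset.mul_sum]
    _ ≤ D * ∑ u ∈ Finset.range (t0 + (t + 1)), F u := by
        have hs := Finset.sum_range_add F t0 (t + 1)
        exact Nat.mul_le_mul_left _ (by omega)
    _ ≤ D * (d * G (t + t0)) := by
        gcongr
        have := h2 (t + t0)
        rwa [show t + t0 + 1 = t0 + (t + 1) by ring] at this
    _ = _ := by ring

theorem auxX_base {k : Type*} [Field k] {n : ℕ} {ι : Type*} [Fintype ι] [DecidableEq ι]
    (pt : ι → Fin n → k)
    (e : ι → MvPolynomial (Fin n) k) (he : ∀ i j, eval (pt i) (e j) = if i = j then 1 else 0)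
    (t0 : ℕ) (ht0 : ∀ i, (e i).totalDegree ≤ t0)
    (I : Ideal (MvPolynomial (Fin n) k)) (hI : ∀ s, I ≤ RingHom.ker (eval (pt s))) (t : ℕ) :
    Fintype.card ι ≤ auxH (sInf (auxX pt I)) (t + t0) := by
  set J := sInf (auxX pt I) with hJ
  have hJs : ∀ s, J ≤ RingHom.ker (eval (pt s)) := by
    intro s
    have hker : (RingHom.ker (eval (pt s))).IsPrime := RingHom.ker_isPrime _
    obtain ⟨p, hp, hle⟩ := Ideal.exists_minimalPrimes_le (hI s)
    exact (sInf_le (show p ∈ auxX pt I from ⟨hp, s, hle⟩)).trans hle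
  unfold auxH
  let v : ι → (restrictTotalDegree (Fin n) k (t + t0)).map (Ideal.Quotient.mkₐ k J).toLinearMap :=
    fun i => ⟨Ideal.Quotient.mk J (e i), e i, (mem_restrictTotalDegree _ _ _).mpr
      ((ht0 i).trans (Nat.le_add_left _ _)), rfl⟩
  have hv : LinearIndependent k v := by
    rw [Fintype.linearIndependent_iff]
    intro g hg j
    have h1 : Ideal.Quotient.mkₐ k J (∑ i, g i • e i) = 0 := by
      have := congrArg Subtype.val hg
      simpa [v, map_sum, map_smul] using this
    have h2 : ∑ i, g i • e i ∈ J := Ideal.Quotient.eq_zero_iff_mem.mp h1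
    have h3 := hJs j h2
    simpa [RingHom.mem_ker, map_sum, smul_eval, he] using h3
  exact hv.fintype_card_le_finrank

theorem aux_choose {k : Type*} [Field k] [Infinite k] {n : ℕ} (y : Fin n → MvPolynomial (Fin n) k)
    (X : Set (Ideal (MvPolynomial (Fin n) k))) (hX : X.Finite) (hy : ∀ p ∈ X, ∃ i, y i ∉ p) :
    ∃ a : Fin n → k, ∀ p ∈ X, ∑ i, a i • y i ∉ p := by
  classical
  let Φ : (Fin n → k) →ₗ[k] MvPolynomial (Fin n) k := Fintype.linearCombination k y
  let W : Ideal (MvPolynomial (Fin n) k) → Subspace k (Fin n → k) :=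
    fun p => (p.restrictScalars k).comap Φ
  have h := Subspace.biUnion_ne_univ_of_top_notMem (s := hX.toFinset.image W) (by
    intro htop
    obtain ⟨p, hp, hpt⟩ := Finset.mem_image.mp htop
    obtain ⟨i, hi⟩ := hy p (by simpa using hp)
    have : Pi.single i (1 : k) ∈ W p := by rw [hpt]; trivial
    apply hi
    simpa [W, Φ, Fintype.linearCombination_apply_single] using this)
  obtain ⟨a, ha⟩ := (Set.ne_univ_iff_exists_notMem _).mp h
  refine ⟨a, fun p hp hmem => ha ?_⟩
  refine Set.mem_biUnion (x := W p) ?_ ?_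
  · exact Finset.mem_coe.mpr (Finset.mem_image.mpr ⟨p, by simpa using hp, rfl⟩)
  · exact hmem

theorem aux_dim_zero {k : Type*} [Field k] {n : ℕ} (q : ℕ) (hq : 1 < q)
    (p : Ideal (MvPolynomial (Fin n) k)) (hp : ∀ i, X i ^ q - X i ∈ p) :
    ringKrullDim (MvPolynomial (Fin n) k ⧸ p) ≤ 0 := by
  have hint : Algebra.IsIntegral k (MvPolynomial (Fin n) k ⧸ p) := by
    constructor
    intro x
    obtain ⟨f, rfl⟩ := Ideal.Quotient.mk_surjective x
    induction f using MvPolynomial.induction_on with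
    | C a => exact isIntegral_algebraMap (R := k) (A := MvPolynomial (Fin n) k ⧸ p) (x := a)
    | add f g hf hg => rw [map_add]; exact hf.add hg
    | mul_X f i hf =>
      rw [map_mul]
      refine hf.mul ⟨Polynomial.X ^ q - Polynomial.X, ?_, ?_⟩
      · exact Polynomial.monic_X_pow_sub (by simpa using hq)
      · have := Ideal.Quotient.eq_zero_iff_mem.mpr (hp i)
        simpa using this
  refine (aux_dim_le_of_integral (R := k)).trans ?_
  rw [ringKrullDim_eq_zero_of_field]

theorem aux_phase2 {k : Type*} [Field k] [Infinite k] {n : ℕ} {ι : Type*} [Fintype ι]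
    [DecidableEq ι] (pt : ι → Fin n → k)
    (e : ι → MvPolynomial (Fin n) k) (he : ∀ i j, eval (pt i) (e j) = if i = j then 1 else 0)
    (t0 : ℕ) (ht0 : ∀ i, (e i).totalDegree ≤ t0) (q : ℕ) (hq : 1 < q)
    (hpt : ∀ s i, pt s i ^ q = pt s i) (r : ℕ)
    (I : Ideal (MvPolynomial (Fin n) k)) (hI : ∀ s, I ≤ RingHom.ker (eval (pt s)))
    (hdim : ∀ p ∈ auxX pt I, (r : WithBot ℕ∞) ≤ ringKrullDim (MvPolynomial (Fin n) k ⧸ p))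
    (t : ℕ) :
    Fintype.card ι * (t + r).choose r ≤ q ^ r * auxH (sInf (auxX pt I)) (t + t0) := by
  induction r generalizing I t with
  | zero => simpa using auxX_base pt e he t0 ht0 I hI t
  | succ r ih =>
    obtain ⟨a, ha⟩ := aux_choose (fun i => (X i ^ q - X i : MvPolynomial (Fin n) k)) (auxX pt I)
      ((Ideal.finite_minimalPrimes_of_isNoetherianRing _ I).subset fun p hp => hp.1) (by
        intro p hp
        by_contra! hcon
        have h1 := (hdim p hp).trans (aux_dim_zero q hq p hcon)
        have h2 : r + 1 ≤ 0 := by exact_mod_cast h1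
        omega)
    set f := ∑ i, a i • (X i ^ q - X i : MvPolynomial (Fin n) k) with hf
    have hfd : f.totalDegree ≤ q := by
      rw [← mem_restrictTotalDegree]
      refine Submodule.sum_mem _ fun i _ => Submodule.smul_mem _ _ (Submodule.sub_mem _ ?_ ?_)
      · rw [mem_restrictTotalDegree, totalDegree_X_pow]
      · rw [mem_restrictTotalDegree, totalDegree_X]; omega
    have h3 := ih (I ⊔ Ideal.span {f})
      (fun s => sup_le (hI s) (by
        rw [Ideal.span_singleton_le_iff_mem, RingHom.mem_ker, hf, map_sum]
        refine Finset.sum_eq_zero fun i _ => ?_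
        simp [smul_eval, hpt]))
      (auxX_dim pt I f r hdim)
    have h4 := auxX_sum pt I f ha q hfd hq.le
    have h5 := aux_comb _ _ _ r t0 _ _ h3 h4 t
    rwa [← pow_succ'] at h5

theorem aux_phase1 {k : Type*} [Field k] [Infinite k] {n : ℕ} {ι : Type*} [Fintype ι]
    [DecidableEq ι] (pt : ι → Fin n → k)
    (e : ι → MvPolynomial (Fin n) k) (he : ∀ i j, eval (pt i) (e j) = if i = j then 1 else 0)
    (t0 : ℕ) (ht0 : ∀ i, (e i).totalDegree ≤ t0) (q : ℕ) (hq : 1 < q)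
    (hpt : ∀ s i, pt s i ^ q = pt s i) (m : ℕ)
    (L : List (MvPolynomial (Fin n) k)) (hL : ∀ s, ∀ f ∈ L, eval (pt s) f = 0)
    (I : Ideal (MvPolynomial (Fin n) k)) (hI : ∀ s, I ≤ RingHom.ker (eval (pt s)))
    (hdim : ∀ p ∈ auxX pt I, ((L.length + m : ℕ) : WithBot ℕ∞) ≤
      ringKrullDim (MvPolynomial (Fin n) k ⧸ p))
    (hup : ∀ p : Ideal (MvPolynomial (Fin n) k), p.IsPrime → I ≤ p → (∀ f ∈ L, f ∈ p) →
      ¬ (((m + 1 : ℕ) : WithBot ℕ∞) ≤ ringKrullDim (MvPolynomial (Fin n) k ⧸ p)))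
    (t : ℕ) :
    Fintype.card ι * (t + (L.length + m)).choose (L.length + m) ≤
      ((L.map totalDegree).prod * q ^ m) * auxH (sInf (auxX pt I)) (t + t0) := by
  induction L generalizing I t with
  | nil =>
    simp only [List.length_nil, zero_add] at hdim ⊢
    simpa using aux_phase2 pt e he t0 ht0 q hq hpt m I hI hdim t
  | cons f L ih =>
    rcases isEmpty_or_nonempty ι with hempty | ⟨⟨s0⟩⟩
    · simp
    have e1 : (f :: L).length + m = (L.length + m) + 1 := by
      rw [List.length_cons]; omega
    rw [e1] at hdim ⊢
    have hfp : ∀ p ∈ auxX pt I, f ∉ p := by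
      rintro p hp hfp
      have hpX := hp
      obtain ⟨hp, s, hs⟩ := hp
      obtain ⟨p', h1, h2, h3, h4⟩ := aux_chain (pt s) L
        (fun g hg => hL s g (by simp [hg])) (m + 1) p hp.1.1 hs (hdim p hpX)
      refine hup p' h1 (hp.1.2.trans h2) ?_ h4
      intro g hg
      rcases List.mem_cons.mp hg with rfl | hg
      · exact h2 hfp
      · exact h3 g hg
    have hd1 : 1 ≤ f.totalDegree := by
      by_contra hcon
      have h0 : f.totalDegree = 0 := by omega
      rw [totalDegree_eq_zero_iff_eq_C] at h0
      have h1 := hL s0 f (by simp)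
      rw [h0, eval_C] at h1
      rw [h1, C_0] at h0
      have hker : (RingHom.ker (eval (pt s0))).IsPrime := RingHom.ker_isPrime _
      obtain ⟨p, hp, hle⟩ := Ideal.exists_minimalPrimes_le (hI s0)
      exact hfp p ⟨hp, s0, hle⟩ (by rw [h0]; exact p.zero_mem)
    have h3 := ih (fun s g hg => hL s g (by simp [hg])) (I ⊔ Ideal.span {f})
      (fun s => sup_le (hI s) (by
        rw [Ideal.span_singleton_le_iff_mem]
        exact hL s f (by simp)))
      (auxX_dim pt I f _ hdim)
      (fun p hp hIp hLp => hup p hp (le_sup_left.trans hIp) (by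
        intro g hg
        rcases List.mem_cons.mp hg with rfl | hg
        · exact hIp (Ideal.mem_sup_right (Ideal.mem_span_singleton_self g))
        · exact hLp g hg))
    have h4 := auxX_sum pt I f hfp f.totalDegree le_rfl hd1
    have h5 := aux_comb _ _ _ _ t0 _ _ h3 h4 t
    rw [List.map_cons, List.prod_cons, mul_assoc f.totalDegree]
    exact h5

theorem stmt15 (K : Type*) [Field K] [Fintype K] (c n : ℕ) (hcn : c ≤ n)
    (d : Fin c → ℕ) (P : Fin c → MvPolynomial (Fin n) K)
    (hdeg : ∀ i, (P i).totalDegree = d i)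
    (hdim : ringKrullDim (MvPolynomial (Fin n) (AlgebraicClosure K) ⧸
        Ideal.span (Set.range fun i =>
          MvPolynomial.map (algebraMap K (AlgebraicClosure K)) (P i)))
      = ((n - c : ℕ) : WithBot ℕ∞)) :
    Nat.card {x : Fin n → K // ∀ i, eval x (P i) = 0}
      ≤ Fintype.card K ^ (n - c) * ∏ i, d i := by
  classical
  set k := AlgebraicClosure K with hk
  have hinf : Infinite k := IsAlgClosed.instInfinite
  let φ : K →+* k := algebraMap K k
  have hφ : Function.Injective φ := φ.injective
  let ι := {x : Fin n → K // ∀ i, eval x (P i) = 0}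
  let pt : ι → Fin n → k := fun s i => φ (s.1 i)
  have hev : ∀ (s : ι) (f : MvPolynomial (Fin n) K), eval (pt s) (map φ f) = φ (eval s.1 f) := by
    intro s f
    rw [eval_map]
    exact (eval₂_comp φ s.1 f).symm
  let e : ι → MvPolynomial (Fin n) k := fun s => map φ (indicator s.1)
  have he : ∀ i j, eval (pt i) (e j) = if i = j then 1 else 0 := by
    intro i j
    rw [hev]
    split_ifs with h
    · rw [h, eval_indicator_apply_eq_one, map_one]
    · rw [eval_indicator_apply_eq_zero _ _ (fun h' => h (Subtype.ext h')), map_zero]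
  let t0 := Finset.univ.sup fun i => (e i).totalDegree
  have ht0 : ∀ i, (e i).totalDegree ≤ t0 := fun i =>
    Finset.le_sup (f := fun i => (e i).totalDegree) (Finset.mem_univ i)
  have hq : 1 < Fintype.card K := Fintype.one_lt_card
  have hpt : ∀ s i, pt s i ^ Fintype.card K = pt s i := by
    intro s i
    simp only [pt]
    rw [← map_pow, FiniteField.pow_card]
  let L : List (MvPolynomial (Fin n) k) := List.ofFn fun i => map φ (P i)
  have hLlen : L.length + (n - c) = n := by
    simp only [L, List.length_ofFn]; omega
  have hLmem : ∀ f ∈ L, ∃ i, map φ (P i) = f := by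
    intro f hf
    simpa [L, List.mem_ofFn] using hf
  have hmain := aux_phase1 pt e he t0 ht0 (Fintype.card K) hq hpt (n - c) L
    (by
      intro s f hf
      obtain ⟨i, rfl⟩ := hLmem f hf
      rw [hev, s.2 i, map_zero])
    ⊥ (fun s => bot_le)
    (by
      rintro p ⟨hp, -⟩
      have : p = ⊥ := by
        rw [Ideal.minimalPrimes_eq_subsingleton_self] at hp
        exact hp
      rw [hLlen, this, ringKrullDim_eq_of_ringEquiv (RingEquiv.quotientBot _),
        MvPolynomial.ringKrullDim_of_isNoetherianRing]
      simp)
    (by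
      intro p hp _ hLp hcon
      have hle : Ideal.span (Set.range fun i => map φ (P i)) ≤ p := by
        rw [Ideal.span_le]
        rintro _ ⟨i, rfl⟩
        exact hLp _ (by simp [L, List.mem_ofFn])
      have h1 : ringKrullDim (MvPolynomial (Fin n) k ⧸ p) ≤ ((n - c : ℕ) : WithBot ℕ∞) := by
        rw [← hdim]
        exact ringKrullDim_le_of_surjective (Ideal.Quotient.factor hle)
          (Ideal.Quotient.factor_surjective hle)
      have h2 : n - c + 1 ≤ n - c := by exact_mod_cast hcon.trans h1
      omega)
  rw [hLlen] at hmain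
  have hprod : (L.map totalDegree).prod = ∏ i, d i := by
    simp only [L, List.map_ofFn, List.prod_ofFn]
    refine Finset.prod_congr rfl fun i _ => ?_
    rw [← hdeg i, Function.comp_apply]
    unfold totalDegree
    rw [support_map_of_injective _ hφ]
  rw [hprod] at hmain
  have hfin : Fintype.card ι ≤ (∏ i, d i) * Fintype.card K ^ (n - c) := by
    refine aux_limit _ _ n t0 fun t => (hmain t).trans ?_
    exact Nat.mul_le_mul_left _ ((auxH_le _ _).trans (aux_finrank _))
  rw [Nat.card_eq_fintype_card, mul_comm]
  exact hfin
end
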